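/- arXiv:1708.05149 — 2 statements merged into one kernel-verified Lean document; each statement's English description precedes it below -/
import Mathlib

section
/- There exist absolute constants C, c > 0 such that the following holds. Let ‖·‖ be a 1-unconditional norm on ℝⁿ which is in position of minimal M and let X = (ℝⁿ, ‖·‖). Then the critical dimension satisfies k(X) ≥ c·log n, and for all t > 0, P( | ‖G‖ − E‖G‖ | > t · E‖G‖ ) ≤ C exp( −c · max{t², t} · log n ), where G is a standard n-dimensional Gaussian vector. -/
open MeasureTheory ProbabilityTheory Real

/-- The standard Gaussian measure `γₙ` on `ℝⁿ`. -/
noncomputable def stdGaussian (n : ℕ) : Measure (Fin n → ℝ) :=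
  Measure.pi fun _ => gaussianReal 0 1

/-- The Euclidean norm on `ℝⁿ`. -/
noncomputable def euclNorm {n : ℕ} (x : Fin n → ℝ) : ℝ :=
  Real.sqrt (∑ i, (x i) ^ 2)

/-- `b(X) = max{ N θ : ‖θ‖₂ = 1 }`, the Lipschitz constant of the norm `N`. -/
noncomputable def bConst {n : ℕ} (N : (Fin n → ℝ) → ℝ) : ℝ :=
  sSup {s | ∃ θ : Fin n → ℝ, euclNorm θ = 1 ∧ s = N θ}

/-- The critical dimension (Dvoretzky number) `k(X) = (E N(G) / b(X))²`. -/
noncomputable def critDim (n : ℕ) (N : (Fin n → ℝ) → ℝ) : ℝ :=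
  ((∫ x, N x ∂stdGaussian n) / bConst N) ^ 2

/-- A norm `N` on `ℝⁿ` is in position of minimal `M` if `E N(G) ≤ E N(TG)` for every
linear map `T` of determinant 1. -/
def MinimalMPosition (n : ℕ) (N : (Fin n → ℝ) → ℝ) : Prop :=
  ∀ T : (Fin n → ℝ) →ₗ[ℝ] (Fin n → ℝ), LinearMap.det T = 1 →
    (∫ x, N x ∂stdGaussian n) ≤ ∫ x, N (T x) ∂stdGaussian n

lemma MeasureTheory.MeasurePreserving.integral_comp_of_aestronglyMeasurable {α β : Type*}
    [MeasurableSpace α] [MeasurableSpace β] {μ : Measure α} {ν : Measure β} {f : α → β}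
    (hf : MeasurePreserving f μ ν) {g : β → ℝ} (hg : AEStronglyMeasurable g ν) :
    ∫ x, g (f x) ∂μ = ∫ y, g y ∂ν := by
  have h := integral_map hf.measurable.aemeasurable (f := g) (by rwa [hf.map_eq])
  rw [hf.map_eq] at h
  exact h.symm

section Mehler

variable {E : Type*} [NormedAddCommGroup E] [NormedSpace ℝ E] [MeasurableSpace E] [BorelSpace E]
  [SecondCountableTopology E] [CompleteSpace E] {μ : Measure E} [IsGaussian μ]

lemma exists_cos_sin_eq {a b : ℝ} (hab : a ^ 2 + b ^ 2 = 1) :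
    ∃ θ : ℝ, Real.cos θ = a ∧ Real.sin θ = b := by
  have hz : ‖(⟨a, b⟩ : ℂ)‖ = 1 := by
    rw [Complex.norm_def, Complex.normSq_mk, ← sq, ← sq, hab, Real.sqrt_one]
  have h0 : (⟨a, b⟩ : ℂ) ≠ 0 := by
    intro h
    simp [h] at hz
  refine ⟨Complex.arg ⟨a, b⟩, ?_, ?_⟩
  · rw [Complex.cos_arg h0, hz, div_one]
  · rw [Complex.sin_arg, hz, div_one]

/-- The product of a centered Gaussian measure with itself is invariant under reflections. -/
lemma measurePreserving_reflection (hμ : μ[id] = 0) {a b : ℝ} (hab : a ^ 2 + b ^ 2 = 1) :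
    MeasurePreserving (fun p : E × E => (a • p.1 + b • p.2, b • p.1 - a • p.2))
      (μ.prod μ) (μ.prod μ) := by
  obtain ⟨θ, hc, hs⟩ := exists_cos_sin_eq (a := b) (b := -a) (by linarith [neg_sq a])
  have h := IsGaussian.map_rotation_eq_self hμ θ
  have h1 : MeasurePreserving (ContinuousLinearMap.rotation θ) (μ.prod μ) (μ.prod μ) :=
    ⟨by fun_prop, h⟩
  convert (Measure.measurePreserving_swap (μ := μ) (ν := μ)).comp h1 using 1
  funext p
  simp [ContinuousLinearMap.rotation_apply, hc, hs, sub_eq_add_neg]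

lemma measurePreserving_linearComb (hμ : μ[id] = 0) {a b : ℝ} (hab : a ^ 2 + b ^ 2 = 1) :
    MeasurePreserving (fun p : E × E => a • p.1 + b • p.2) (μ.prod μ) μ :=
  measurePreserving_fst.comp (measurePreserving_reflection hμ hab)

/-- Two conditionally independent Gaussian copies of correlation `a` have correlation `a ^ 2`. -/
lemma exists_measurePreserving_noise_comp (hμ : μ[id] = 0) {a b c : ℝ} (hab : a ^ 2 + b ^ 2 = 1)
    (hc : (a ^ 2) ^ 2 + c ^ 2 = 1) (hc0 : c ≠ 0) :
    ∃ M : (E × E) × E → E × E, MeasurePreserving M ((μ.prod μ).prod μ) (μ.prod μ) ∧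
      ∀ p, (M p).1 = a • p.1.1 + b • p.1.2 ∧
        a ^ 2 • (M p).1 + c • (M p).2 = a • p.1.1 + b • p.2 := by
  have hcoef : (a * b / c) ^ 2 + (b / c) ^ 2 = 1 := by
    field_simp
    nlinarith
  have h1 := (measurePreserving_reflection hμ hab).prod (MeasurePreserving.id μ)
  have h2 := (MeasurePreserving.id μ).prod (measurePreserving_linearComb hμ hcoef)
  have h3 := h2.comp ((measurePreserving_prodAssoc μ μ μ).comp h1)
  refine ⟨_, h3, fun p => ⟨rfl, ?_⟩⟩
  simp only [Function.comp_apply, Prod.map, MeasurableEquiv.prodAssoc, id,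
    MeasurableEquiv.coe_mk, Equiv.prodAssoc_apply]
  match_scalars <;> field_simp <;> first | ring1 | linear_combination a * hab

lemma measurePreserving_prodProdProdComm :
    MeasurePreserving (fun p : (E × E) × (E × E) => ((p.1.1, p.2.1), (p.1.2, p.2.2)))
      ((μ.prod μ).prod (μ.prod μ)) ((μ.prod μ).prod (μ.prod μ)) := by
  have h1 := measurePreserving_prodAssoc μ μ (μ.prod μ)
  have h2 := (MeasurePreserving.id μ).prod (measurePreserving_prodAssoc μ μ μ).symm
  have h3 := (MeasurePreserving.id μ).prod
    ((Measure.measurePreserving_swap (μ := μ) (ν := μ)).prod (MeasurePreserving.id μ))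
  have h4 := (MeasurePreserving.id μ).prod (measurePreserving_prodAssoc μ μ μ)
  have h5 := (measurePreserving_prodAssoc μ μ (μ.prod μ)).symm
  exact h5.comp (h4.comp (h3.comp (h2.comp h1)))

lemma sq_sqrt_two_inv : (√2)⁻¹ ^ 2 + (√2)⁻¹ ^ 2 = (1 : ℝ) := by
  rw [inv_pow, Real.sq_sqrt (by norm_num)]
  norm_num

/-- Three conditionally independent Gaussian copies of correlation `1 / √2` can be written as the
normalized pairwise sums of three independent copies. -/
lemma exists_measurePreserving_triple (hμ : μ[id] = 0) :
    ∃ M : (E × E) × (E × E) → (E × E) × (E × E),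
      MeasurePreserving M ((μ.prod μ).prod (μ.prod μ)) ((μ.prod μ).prod (μ.prod μ)) ∧
      ∀ p, (M p).1.1 + (M p).1.2 = p.1.1 + p.1.2 ∧ (M p).1.1 + (M p).2.2 = p.1.1 + p.2.1 ∧
        (M p).1.2 + (M p).2.2 = p.1.1 + p.2.2 := by
  have h1 := (measurePreserving_reflection hμ sq_sqrt_two_inv).prod
    (measurePreserving_reflection hμ (a := (√2)⁻¹) (b := -(√2)⁻¹)
      (by rw [neg_sq]; exact sq_sqrt_two_inv))
  have h2 := (measurePreserving_reflection hμ sq_sqrt_two_inv).prod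
    (measurePreserving_reflection hμ sq_sqrt_two_inv)
  refine ⟨_, h2.comp (measurePreserving_prodProdProdComm.comp h1), fun p => ?_⟩
  have hr := sq_sqrt_two_inv
  simp only [Function.comp_apply, Prod.map]
  refine ⟨?_, ?_, ?_⟩ <;> match_scalars <;> first | ring1 | linear_combination hr

end Mehler

section Hypercontractivity

lemma lintegral_mul_le_sqrt {α : Type*} [MeasurableSpace α] {ν : Measure α} {f g : α → ENNReal}
    (hf : AEMeasurable f ν) (hg : AEMeasurable g ν) :
    ∫⁻ x, f x * g x ∂ν ≤ (∫⁻ x, f x ^ 2 ∂ν) ^ (1 / 2 : ℝ) * (∫⁻ x, g x ^ 2 ∂ν) ^ (1 / 2 : ℝ) := by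
  have := ENNReal.lintegral_mul_le_Lp_mul_Lq ν Real.HolderConjugate.two_two hf hg
  simpa using this

/-- The Loomis-Whitney inequality for a symmetric kernel. -/
lemma lintegral_triple_kernel_le {α : Type*} [MeasurableSpace α] {ν : Measure α} [SFinite ν]
    {k : α → α → ENNReal} (hk : Measurable (Function.uncurry k)) :
    ∫⁻ x, ∫⁻ y, k x y * ∫⁻ z, k x z * k y z ∂ν ∂ν ∂ν
      ≤ (∫⁻ x, ∫⁻ y, k x y ^ 2 ∂ν ∂ν) ^ (3 / 2 : ℝ) := by
  set κ : α → ENNReal := fun x => ∫⁻ y, k x y ^ 2 ∂ν with hκ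
  have hκm : Measurable κ := (hk.pow_const 2).lintegral_prod_right'
  have hkx (x) : Measurable (k x) := hk.comp measurable_prodMk_left
  have h1 : ∀ x y, ∫⁻ z, k x z * k y z ∂ν ≤ κ x ^ (1 / 2 : ℝ) * κ y ^ (1 / 2 : ℝ) := fun x y =>
    lintegral_mul_le_sqrt (hkx x).aemeasurable (hkx y).aemeasurable
  calc ∫⁻ x, ∫⁻ y, k x y * ∫⁻ z, k x z * k y z ∂ν ∂ν ∂ν
      ≤ ∫⁻ x, ∫⁻ y, k x y * (κ x ^ (1 / 2 : ℝ) * κ y ^ (1 / 2 : ℝ)) ∂ν ∂ν := by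
        gcongr with x y
        exact h1 x y
    _ = ∫⁻ p : α × α, Function.uncurry k p * (κ p.1 ^ (1 / 2 : ℝ) * κ p.2 ^ (1 / 2 : ℝ))
          ∂(ν.prod ν) := by
        rw [lintegral_prod]
        · rfl
        · fun_prop
    _ ≤ (∫⁻ p, Function.uncurry k p ^ 2 ∂(ν.prod ν)) ^ (1 / 2 : ℝ) *
          (∫⁻ p : α × α, (κ p.1 ^ (1 / 2 : ℝ) * κ p.2 ^ (1 / 2 : ℝ)) ^ 2 ∂(ν.prod ν)) ^ (1 / 2 : ℝ) :=
        lintegral_mul_le_sqrt hk.aemeasurable (by fun_prop)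
    _ = (∫⁻ x, κ x ∂ν) ^ (1 / 2 : ℝ) * ((∫⁻ x, κ x ∂ν) * (∫⁻ x, κ x ∂ν)) ^ (1 / 2 : ℝ) := by
        congr 2
        · rw [lintegral_prod _ (by fun_prop)]
          rfl
        · rw [← lintegral_prod_mul hκm.aemeasurable hκm.aemeasurable]
          congr with p
          rw [← ENNReal.mul_rpow_of_nonneg _ _ (by norm_num), ← ENNReal.rpow_natCast,
            ← ENNReal.rpow_mul]
          norm_num
    _ = (∫⁻ x, κ x ∂ν) ^ (3 / 2 : ℝ) := by
        rw [← sq, ← ENNReal.rpow_natCast, ← ENNReal.rpow_mul,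
          ← ENNReal.rpow_add_of_nonneg _ _ (by norm_num) (by norm_num)]
        norm_num

variable {E : Type*} [NormedAddCommGroup E] [NormedSpace ℝ E] [MeasurableSpace E] [BorelSpace E]
  [SecondCountableTopology E] [CompleteSpace E] {μ : Measure E} [IsGaussian μ]

lemma lintegral_noise_cube_le (hμ : μ[id] = 0) {u : E → ENNReal} (hu : Measurable u) :
    ∫⁻ x, (∫⁻ z, u ((√2)⁻¹ • x + (√2)⁻¹ • z) ∂μ) ^ 3 ∂μ ≤ (∫⁻ x, u x ^ 2 ∂μ) ^ (3 / 2 : ℝ) := by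
  set r : ℝ := (√2)⁻¹ with hr
  set k : E → E → ENNReal := fun x z => u (r • x + r • z) with hkdef
  have hk : Measurable (Function.uncurry k) := by
    change Measurable fun p : E × E => u (r • p.1 + r • p.2)
    fun_prop
  have hkx (x) : Measurable (k x) := hk.comp measurable_prodMk_left
  obtain ⟨M, hM, hMp⟩ := exists_measurePreserving_triple hμ
  have hksum {x z x' z' : E} (h : x + z = x' + z') : k x z = k x' z' := by
    simp only [hkdef, ← smul_add, h]
  have h0 : ∫⁻ x, ∫⁻ y, k x y ^ 2 ∂μ ∂μ = ∫⁻ x, u x ^ 2 ∂μ := by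
    rw [← (measurePreserving_linearComb hμ sq_sqrt_two_inv).lintegral_comp (hu.pow_const 2),
      lintegral_prod _ (by fun_prop)]
  set Φ : (E × E) × (E × E) → ENNReal := fun p => k p.1.1 p.1.2 * (k p.1.1 p.2.2 * k p.1.2 p.2.2)
  have hΦ : Measurable Φ := by
    change Measurable fun p : (E × E) × (E × E) => u (r • p.1.1 + r • p.1.2) *
      (u (r • p.1.1 + r • p.2.2) * u (r • p.1.2 + r • p.2.2))
    fun_prop
  calc ∫⁻ x, (∫⁻ z, k x z ∂μ) ^ 3 ∂μ
      = ∫⁻ p : (E × E) × (E × E), k p.1.1 p.1.2 * (k p.1.1 p.2.1 * k p.1.1 p.2.2)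
          ∂((μ.prod μ).prod (μ.prod μ)) := by
        have hm : Measurable fun p : (E × E) × (E × E) =>
            k p.1.1 p.1.2 * (k p.1.1 p.2.1 * k p.1.1 p.2.2) := by
          change Measurable fun p : (E × E) × (E × E) => u (r • p.1.1 + r • p.1.2) *
            (u (r • p.1.1 + r • p.2.1) * u (r • p.1.1 + r • p.2.2))
          fun_prop
        rw [lintegral_prod _ hm.aemeasurable, lintegral_prod _ hm.lintegral_prod_right'.aemeasurable]
        congr with x
        have h2 : ∀ y, ∫⁻ q : E × E, k x y * (k x q.1 * k x q.2) ∂(μ.prod μ)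
            = k x y * ((∫⁻ z, k x z ∂μ) * ∫⁻ z, k x z ∂μ) := fun y => by
          rw [lintegral_const_mul _ (by have := hkx x; fun_prop),
            lintegral_prod_mul (hkx x).aemeasurable (hkx x).aemeasurable]
        simp_rw [h2]
        rw [lintegral_mul_const _ (hkx x), pow_succ', sq]
    _ = ∫⁻ p, Φ (M p) ∂((μ.prod μ).prod (μ.prod μ)) := by
        congr with p
        obtain ⟨e1, e2, e3⟩ := hMp p
        simp only [Φ, hksum e1, hksum e2, hksum e3]
    _ = ∫⁻ p, Φ p ∂((μ.prod μ).prod (μ.prod μ)) := hM.lintegral_comp hΦ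
    _ = ∫⁻ x, ∫⁻ y, k x y * ∫⁻ z, k x z * k y z ∂μ ∂μ ∂μ := by
        rw [lintegral_prod _ hΦ.aemeasurable, lintegral_prod _ hΦ.lintegral_prod_right'.aemeasurable]
        congr with x
        congr with y
        rw [← lintegral_const_mul (f := fun z => k x z * k y z) _ ((hkx x).mul (hkx y))]
        have h4 : ∀ g : E → ENNReal, Measurable g →
            ∫⁻ q : E × E, g q.2 ∂(μ.prod μ) = ∫⁻ z, g z ∂μ := fun g hg =>
          (measurePreserving_snd (μ := μ) (ν := μ)).lintegral_comp hg
        exact h4 (fun z => k x y * (k x z * k y z))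
          (((hkx x).mul (hkx y)).const_mul _)
    _ ≤ (∫⁻ x, ∫⁻ y, k x y ^ 2 ∂μ ∂μ) ^ (3 / 2 : ℝ) := lintegral_triple_kernel_le hk
    _ = (∫⁻ x, u x ^ 2 ∂μ) ^ (3 / 2 : ℝ) := by rw [h0]

/-- A consequence of Gaussian hypercontractivity from `L²` to `L³`. -/
lemma lintegral_noise_sq_le (hμ : μ[id] = 0) {u : E → ENNReal} (hu : Measurable u) :
    ∫⁻ x, (∫⁻ z, u ((√2)⁻¹ • x + (√2)⁻¹ • z) ∂μ) ^ 2 ∂μ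
      ≤ (∫⁻ x, u x ∂μ) ^ (1 / 2 : ℝ) * (∫⁻ x, u x ^ 2 ∂μ) ^ (3 / 4 : ℝ) := by
  set T : E → ENNReal := fun x => ∫⁻ z, u ((√2)⁻¹ • x + (√2)⁻¹ • z) ∂μ with hT
  have hm : Measurable fun p : E × E => u ((√2)⁻¹ • p.1 + (√2)⁻¹ • p.2) := by fun_prop
  have hTm : Measurable T := hm.lintegral_prod_right'
  have h1 : ∫⁻ x, T x ∂μ = ∫⁻ x, u x ∂μ := by
    rw [← (measurePreserving_linearComb hμ sq_sqrt_two_inv).lintegral_comp hu,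
      lintegral_prod _ hm.aemeasurable]
  calc ∫⁻ x, T x ^ 2 ∂μ = ∫⁻ x, T x ^ (1 / 2 : ℝ) * T x ^ (3 / 2 : ℝ) ∂μ := by
        congr with x
        rw [← ENNReal.rpow_add_of_nonneg _ _ (by norm_num) (by norm_num), ← ENNReal.rpow_natCast]
        norm_num
    _ ≤ (∫⁻ x, (T x ^ (1 / 2 : ℝ)) ^ 2 ∂μ) ^ (1 / 2 : ℝ) *
          (∫⁻ x, (T x ^ (3 / 2 : ℝ)) ^ 2 ∂μ) ^ (1 / 2 : ℝ) :=
        lintegral_mul_le_sqrt (by fun_prop) (by fun_prop)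
    _ = (∫⁻ x, u x ∂μ) ^ (1 / 2 : ℝ) * (∫⁻ x, T x ^ 3 ∂μ) ^ (1 / 2 : ℝ) := by
        have e1 (x) : (T x ^ (1 / 2 : ℝ)) ^ 2 = T x := by
          rw [← ENNReal.rpow_natCast, ← ENNReal.rpow_mul]
          norm_num
        have e2 (x) : (T x ^ (3 / 2 : ℝ)) ^ 2 = T x ^ 3 := by
          rw [← ENNReal.rpow_natCast, ← ENNReal.rpow_mul, ← ENNReal.rpow_natCast]
          norm_num
        simp_rw [e1, e2, h1]
    _ ≤ (∫⁻ x, u x ∂μ) ^ (1 / 2 : ℝ) * ((∫⁻ x, u x ^ 2 ∂μ) ^ (3 / 2 : ℝ)) ^ (1 / 2 : ℝ) := by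
        gcongr
        exact lintegral_noise_cube_le hμ hu
    _ = _ := by
        rw [← ENNReal.rpow_mul]
        norm_num

end Hypercontractivity

section EfronStein

variable {ι : Type*} [Fintype ι] {α : Type*} [MeasurableSpace α]
  {ν : Measure α} [IsProbabilityMeasure ν]

/-- Resample the coordinates in `S`. -/
lemma measurePreserving_piecewise_swap (S : Finset ι) [∀ i, Decidable (i ∈ S)] :
    MeasurePreserving (fun p : (ι → α) × (ι → α) => (S.piecewise p.2 p.1, S.piecewise p.1 p.2))
      ((Measure.pi fun _ : ι => ν).prod (Measure.pi fun _ : ι => ν))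
      ((Measure.pi fun _ : ι => ν).prod (Measure.pi fun _ : ι => ν)) := by
  have h1 := measurePreserving_arrowProdEquivProdArrow α α ι (fun _ => ν) (fun _ => ν)
  have h2 : MeasurePreserving
      (fun (q : ι → α × α) i => (if i ∈ S then Prod.swap else id) (q i))
      (Measure.pi fun _ : ι => ν.prod ν) (Measure.pi fun _ : ι => ν.prod ν) := by
    refine measurePreserving_pi _ _ fun i => ?_
    split_ifs
    · exact Measure.measurePreserving_swap
    · exact MeasurePreserving.id _
  convert h1.comp (h2.comp h1.symm) using 1
  funext p
  ext i <;> by_cases hi : i ∈ S <;>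
    simp [hi, MeasurableEquiv.arrowProdEquivProdArrow, Equiv.arrowProdEquivProdArrow,
      Finset.piecewise]

lemma measurePreserving_piecewise (S : Finset ι) [∀ i, Decidable (i ∈ S)] :
    MeasurePreserving (fun p : (ι → α) × (ι → α) => S.piecewise p.2 p.1)
      ((Measure.pi fun _ : ι => ν).prod (Measure.pi fun _ : ι => ν))
      (Measure.pi fun _ : ι => ν) :=
  measurePreserving_fst.comp (measurePreserving_piecewise_swap S)

lemma piecewise_hybrid_le [DecidableEq ι] {h : (ι → α) → ℝ} (hh : MemLp h 2 (Measure.pi fun _ : ι => ν)) {S : Finset ι}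
    {i : ι} (hi : i ∉ S) :
    ∫ p : (ι → α) × (ι → α), h p.1 * (h (S.piecewise p.2 p.1) - h ((insert i S).piecewise p.2 p.1))
        ∂((Measure.pi fun _ : ι => ν).prod (Measure.pi fun _ : ι => ν))
      ≤ (1 / 2) * ∫ p : (ι → α) × (ι → α), (h p.1 - h (({i} : Finset ι).piecewise p.2 p.1)) ^ 2
        ∂((Measure.pi fun _ : ι => ν).prod (Measure.pi fun _ : ι => ν)) := by
  set γ := Measure.pi fun _ : ι => ν with hγ
  have hmem (S : Finset ι) : MemLp (fun p : (ι → α) × (ι → α) => h (S.piecewise p.2 p.1)) 2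
      (γ.prod γ) := hh.comp_measurePreserving (measurePreserving_piecewise S)
  have h1 : MemLp (fun p : (ι → α) × (ι → α) => h p.1) 2 (γ.prod γ) :=
    hh.comp_measurePreserving measurePreserving_fst
  set D : (ι → α) × (ι → α) → ℝ := fun p =>
    h (S.piecewise p.2 p.1) - h ((insert i S).piecewise p.2 p.1)
  set G : (ι → α) × (ι → α) → ℝ := fun p => h p.1 - h (({i} : Finset ι).piecewise p.2 p.1)
  have hD : MemLp D 2 (γ.prod γ) := (hmem S).sub (hmem _)
  have hG : MemLp G 2 (γ.prod γ) := h1.sub (hmem _)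
  set σ : Finset ι → (ι → α) × (ι → α) → (ι → α) × (ι → α) := fun S p =>
    (S.piecewise p.2 p.1, S.piecewise p.1 p.2)
  have hσ (S) : MeasurePreserving (σ S) (γ.prod γ) (γ.prod γ) := measurePreserving_piecewise_swap S
  have hint {F : (ι → α) × (ι → α) → ℝ} (hF : AEStronglyMeasurable F (γ.prod γ)) (S) :
      ∫ p, F (σ S p) ∂(γ.prod γ) = ∫ p, F p ∂(γ.prod γ) :=
    (hσ S).integral_comp_of_aestronglyMeasurable hF
  have e1 : ∫ p, h p.1 * D p ∂(γ.prod γ)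
      = ∫ p, h (({i} : Finset ι).piecewise p.2 p.1) * (- D p) ∂(γ.prod γ) := by
    rw [← hint (F := fun p => h p.1 * D p) (h1.1.mul hD.1) {i}]
    congr with p
    simp only [D, σ]
    have a1 : S.piecewise (({i} : Finset ι).piecewise p.1 p.2) (({i} : Finset ι).piecewise p.2 p.1)
        = (insert i S).piecewise p.2 p.1 := by
      ext j
      by_cases hj : j = i
      · subst hj; simp [Finset.piecewise, hi]
      · by_cases hS : j ∈ S <;> simp [Finset.piecewise, hj, hS]
    have a2 : (insert i S).piecewise (({i} : Finset ι).piecewise p.1 p.2)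
        (({i} : Finset ι).piecewise p.2 p.1) = S.piecewise p.2 p.1 := by
      ext j
      by_cases hj : j = i
      · subst hj; simp [Finset.piecewise, hi]
      · by_cases hS : j ∈ S <;> simp [Finset.piecewise, hj, hS]
    rw [a1, a2]
    ring
  have e2 : ∫ p, D p ^ 2 ∂(γ.prod γ) = ∫ p, G p ^ 2 ∂(γ.prod γ) := by
    rw [← hint (F := fun p => G p ^ 2) hG.integrable_sq.1 S]
    congr with p
    simp only [D, G, σ]
    have a1 : ({i} : Finset ι).piecewise (S.piecewise p.1 p.2) (S.piecewise p.2 p.1)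
        = (insert i S).piecewise p.2 p.1 := by
      ext j
      by_cases hj : j = i
      · subst hj; simp [Finset.piecewise, hi]
      · by_cases hS : j ∈ S <;> simp [Finset.piecewise, hj, hS]
    rw [a1]
  have i1 : Integrable (fun p => h p.1 * D p) (γ.prod γ) := h1.integrable_mul hD
  have i2 : Integrable (fun p => h (({i} : Finset ι).piecewise p.2 p.1) * (- D p)) (γ.prod γ) :=
    (hmem {i}).integrable_mul hD.neg
  have e3 : 2 * ∫ p, h p.1 * D p ∂(γ.prod γ) = ∫ p, G p * D p ∂(γ.prod γ) := by
    rw [two_mul]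
    nth_rewrite 2 [e1]
    rw [← integral_add i1 i2]
    congr with p
    simp only [G]
    ring
  have e4 : ∫ p, G p * D p ∂(γ.prod γ) ≤ ∫ p, (1 / 2) * (G p ^ 2 + D p ^ 2) ∂(γ.prod γ) := by
    refine integral_mono (hG.integrable_mul hD)
      ((hG.integrable_sq.add hD.integrable_sq).const_mul _) fun p => ?_
    simp only
    nlinarith [sq_nonneg (G p - D p)]
  rw [integral_const_mul, integral_add hG.integrable_sq hD.integrable_sq, e2] at e4
  linarith

/-- The Efron-Stein inequality. -/
lemma efron_stein [DecidableEq ι] {h : (ι → α) → ℝ} (hh : MemLp h 2 (Measure.pi fun _ : ι => ν)) :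
    ∫ x, h x ^ 2 ∂(Measure.pi fun _ : ι => ν) - (∫ x, h x ∂(Measure.pi fun _ : ι => ν)) ^ 2
      ≤ (1 / 2) * ∑ i, ∫ p : (ι → α) × (ι → α),
        (h p.1 - h (({i} : Finset ι).piecewise p.2 p.1)) ^ 2
        ∂((Measure.pi fun _ : ι => ν).prod (Measure.pi fun _ : ι => ν)) := by
  set γ := Measure.pi fun _ : ι => ν with hγ
  have hmem (S : Finset ι) : MemLp (fun p : (ι → α) × (ι → α) => h (S.piecewise p.2 p.1)) 2
      (γ.prod γ) := hh.comp_measurePreserving (measurePreserving_piecewise S)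
  have h1 : MemLp (fun p : (ι → α) × (ι → α) => h p.1) 2 (γ.prod γ) :=
    hh.comp_measurePreserving measurePreserving_fst
  have h2 : MemLp (fun p : (ι → α) × (ι → α) => h p.2) 2 (γ.prod γ) :=
    hh.comp_measurePreserving measurePreserving_snd
  have key : ∀ S : Finset ι, ∫ p : (ι → α) × (ι → α), h p.1 * (h p.1 - h (S.piecewise p.2 p.1))
      ∂(γ.prod γ) ≤ (1 / 2) * ∑ i ∈ S, ∫ p : (ι → α) × (ι → α),
        (h p.1 - h (({i} : Finset ι).piecewise p.2 p.1)) ^ 2 ∂(γ.prod γ) := by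
    intro S
    induction S using Finset.induction_on with
    | empty => simp
    | insert i S hi ih =>
      rw [Finset.sum_insert hi, mul_add]
      have := piecewise_hybrid_le hh hi
      rw [← hγ] at this
      have e : ∫ p : (ι → α) × (ι → α), h p.1 * (h p.1 - h ((insert i S).piecewise p.2 p.1))
          ∂(γ.prod γ) = ∫ p : (ι → α) × (ι → α), h p.1 * (h (S.piecewise p.2 p.1) -
            h ((insert i S).piecewise p.2 p.1)) ∂(γ.prod γ)
          + ∫ p : (ι → α) × (ι → α), h p.1 * (h p.1 - h (S.piecewise p.2 p.1)) ∂(γ.prod γ) := by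
        rw [← integral_add]
        · congr with p
          ring
        · exact h1.integrable_mul ((hmem _).sub (hmem _))
        · exact h1.integrable_mul (h1.sub (hmem _))
      rw [e]
      linarith
  refine le_trans (le_of_eq ?_) (key Finset.univ)
  simp only [Finset.piecewise_univ, mul_sub]
  have i1 : Integrable (fun p : (ι → α) × (ι → α) => h p.1 * h p.1) (γ.prod γ) :=
    h1.integrable_mul h1
  have i2 : Integrable (fun p : (ι → α) × (ι → α) => h p.1 * h p.2) (γ.prod γ) :=
    h1.integrable_mul h2
  rw [integral_sub i1 i2, integral_prod_mul h h, sq (∫ x, h x ∂γ),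
    integral_fun_fst (μ := γ) (ν := γ) (fun x => h x * h x)]
  simp [sq]

end EfronStein

section NoiseCorrelation

variable {E : Type*} [NormedAddCommGroup E] [NormedSpace ℝ E] [MeasurableSpace E] [BorelSpace E]
  [SecondCountableTopology E] [CompleteSpace E] {μ : Measure E} [IsGaussian μ]

/-- `E g(X) g(aX + bY)` for independent `X`, `Y` with law `μ`. -/
noncomputable def noiseCorr (μ : Measure E) (g : E → ℝ) (a b : ℝ) : ℝ :=
  ∫ p : E × E, g p.1 * g (a • p.1 + b • p.2) ∂(μ.prod μ)

lemma integral_noise_sq_eq (hμ : μ[id] = 0) {a b c : ℝ} (hab : a ^ 2 + b ^ 2 = 1)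
    (hc : (a ^ 2) ^ 2 + c ^ 2 = 1) (hc0 : c ≠ 0) {g : E → ℝ} (hg : MemLp g 2 μ) :
    ∫ x, (∫ z, g (a • x + b • z) ∂μ) ^ 2 ∂μ = noiseCorr μ g (a ^ 2) c := by
  obtain ⟨M, hM, hMp⟩ := exists_measurePreserving_noise_comp hμ hab hc hc0
  have hfst : MeasurePreserving (fun p : (E × E) × E => (p.1.1, p.2))
      ((μ.prod μ).prod μ) (μ.prod μ) :=
    (measurePreserving_fst (μ := μ) (ν := μ)).prod (MeasurePreserving.id μ)
  have hlin := measurePreserving_linearComb hμ hab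
  have i1 : MemLp (fun p : (E × E) × E => g (a • p.1.1 + b • p.1.2)) 2 ((μ.prod μ).prod μ) :=
    hg.comp_measurePreserving (hlin.comp measurePreserving_fst)
  have i2 : MemLp (fun p : (E × E) × E => g (a • p.1.1 + b • p.2)) 2 ((μ.prod μ).prod μ) :=
    hg.comp_measurePreserving (hlin.comp hfst)
  have hQ : AEStronglyMeasurable (fun p : E × E => g p.1 * g (a ^ 2 • p.1 + c • p.2))
      (μ.prod μ) := by
    have j1 : MemLp (fun p : E × E => g p.1) 2 (μ.prod μ) :=
      hg.comp_measurePreserving measurePreserving_fst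
    have j2 : MemLp (fun p : E × E => g (a ^ 2 • p.1 + c • p.2)) 2 (μ.prod μ) :=
      hg.comp_measurePreserving (measurePreserving_linearComb hμ hc)
    exact j1.1.mul j2.1
  have e : noiseCorr μ g (a ^ 2) c = ∫ p : (E × E) × E, g (a • p.1.1 + b • p.1.2) *
      g (a • p.1.1 + b • p.2) ∂((μ.prod μ).prod μ) := by
    rw [noiseCorr, ← hM.integral_comp_of_aestronglyMeasurable hQ]
    congr with p
    rw [(hMp p).2, (hMp p).1]
  have hint : Integrable (fun p : (E × E) × E => g (a • p.1.1 + b • p.1.2) *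
      g (a • p.1.1 + b • p.2)) ((μ.prod μ).prod μ) := i1.integrable_mul i2
  have hA := measurePreserving_prodAssoc μ μ μ
  have hint' : Integrable (fun p : E × (E × E) => g (a • p.1 + b • p.2.1) *
      g (a • p.1 + b • p.2.2)) (μ.prod (μ.prod μ)) :=
    (hA.symm.integrable_comp hint.aestronglyMeasurable).2 hint
  rw [e, ← hA.symm.integral_comp_of_aestronglyMeasurable hint.1]
  change _ = ∫ p : E × (E × E), g (a • p.1 + b • p.2.1) * g (a • p.1 + b • p.2.2) ∂_
  rw [integral_prod _ hint']
  congr with x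
  simp only
  rw [integral_prod_mul (fun y => g (a • x + b • y)) (fun y => g (a • x + b • y)), sq]

lemma integral_sub_noise_sq (hμ : μ[id] = 0) {a b : ℝ} (hab : a ^ 2 + b ^ 2 = 1)
    {g : E → ℝ} (hg : MemLp g 2 μ) :
    ∫ p : E × E, (g p.1 - g (a • p.1 + b • p.2)) ^ 2 ∂(μ.prod μ)
      = 2 * (∫ x, g x ^ 2 ∂μ - noiseCorr μ g a b) := by
  have j1 : MemLp (fun p : E × E => g p.1) 2 (μ.prod μ) :=
    hg.comp_measurePreserving measurePreserving_fst
  have j2 : MemLp (fun p : E × E => g (a • p.1 + b • p.2)) 2 (μ.prod μ) :=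
    hg.comp_measurePreserving (measurePreserving_linearComb hμ hab)
  have i1 := j1.integrable_sq
  have i2 := j2.integrable_sq
  have i3 : Integrable (fun p : E × E => g p.1 * g (a • p.1 + b • p.2)) (μ.prod μ) :=
    j1.integrable_mul j2
  have e1 : ∫ p : E × E, g p.1 ^ 2 ∂(μ.prod μ) = ∫ x, g x ^ 2 ∂μ :=
    measurePreserving_fst.integral_comp_of_aestronglyMeasurable hg.integrable_sq.1
  have e2 : ∫ p : E × E, g (a • p.1 + b • p.2) ^ 2 ∂(μ.prod μ) = ∫ x, g x ^ 2 ∂μ :=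
    (measurePreserving_linearComb hμ hab).integral_comp_of_aestronglyMeasurable
      hg.integrable_sq.1
  have : ∀ p : E × E, (g p.1 - g (a • p.1 + b • p.2)) ^ 2
      = (g p.1 ^ 2 + g (a • p.1 + b • p.2) ^ 2) - 2 * (g p.1 * g (a • p.1 + b • p.2)) :=
    fun p => by ring
  simp_rw [this]
  have i12 : Integrable (fun p : E × E => g p.1 ^ 2 + g (a • p.1 + b • p.2) ^ 2) (μ.prod μ) :=
    i1.add i2
  rw [integral_sub i12 (i3.const_mul 2), integral_add i1 i2, e1, e2, integral_const_mul,
    noiseCorr]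
  ring

lemma noiseCorr_sq_le (hμ : μ[id] = 0) {a b c : ℝ} (hab : a ^ 2 + b ^ 2 = 1)
    (hc : (a ^ 2) ^ 2 + c ^ 2 = 1) (hc0 : c ≠ 0) {g : E → ℝ} (hg : MemLp g 2 μ) :
    noiseCorr μ g a b ^ 2 ≤ noiseCorr μ g (a ^ 2) c * ∫ x, g x ^ 2 ∂μ := by
  have hlin := measurePreserving_linearComb hμ hab
  have j1 : MemLp (fun p : E × E => g p.1) 2 (μ.prod μ) :=
    hg.comp_measurePreserving measurePreserving_fst
  have j2 : MemLp (fun p : E × E => g (a • p.1 + b • p.2)) 2 (μ.prod μ) :=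
    hg.comp_measurePreserving hlin
  set T : E → ℝ := fun x => ∫ z, g (a • x + b • z) ∂μ with hT
  have hTm : AEStronglyMeasurable T μ := j2.1.integral_prod_right'
  have hT2 : MemLp T 2 μ := by
    refine (memLp_two_iff_integrable_sq hTm).2 ?_
    refine Integrable.mono' (j2.integrable_sq.integral_prod_left) (hTm.pow 2) ?_
    have hi := (integrable_prod_iff j2.1).1 (j2.integrable one_le_two)
    have hi2 := (integrable_prod_iff j2.integrable_sq.1).1 j2.integrable_sq
    filter_upwards [hi.1, hi2.1] with x hx hx2
    rw [Real.norm_of_nonneg (sq_nonneg _)]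
    exact (Even.convexOn_pow (𝕜 := ℝ) even_two).map_integral_le
      (continuous_pow 2).continuousOn isClosed_univ (by simp) hx hx2
  have e1 : noiseCorr μ g a b = ∫ x, g x * T x ∂μ := by
    have : Integrable (fun p : E × E => g p.1 * g (a • p.1 + b • p.2)) (μ.prod μ) :=
      j1.integrable_mul j2
    rw [noiseCorr, integral_prod _ this]
    simp only [integral_const_mul, hT]
  rw [← integral_noise_sq_eq hμ hab hc hc0 hg, e1]
  have i3 : Integrable (fun x => g x * T x) μ := hg.integrable_mul hT2
  have h : ∀ t : ℝ, 0 ≤ (∫ x, g x ^ 2 ∂μ) * (t * t) + (2 * ∫ x, g x * T x ∂μ) * t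
      + ∫ x, T x ^ 2 ∂μ := by
    intro t
    have : 0 ≤ ∫ x, (g x * t + T x) ^ 2 ∂μ := integral_nonneg fun x => sq_nonneg _
    convert this using 1
    have e : ∀ x, (g x * t + T x) ^ 2 = (g x ^ 2 * (t * t) + (2 * (g x * T x)) * t) + T x ^ 2 :=
      fun x => by ring
    simp_rw [e]
    have i4 : Integrable (fun x => g x ^ 2 * (t * t) + (2 * (g x * T x)) * t) μ :=
      (hg.integrable_sq.mul_const _).add ((i3.const_mul 2).mul_const _)
    rw [integral_add i4
      hT2.integrable_sq, integral_add (hg.integrable_sq.mul_const _)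
      ((i3.const_mul 2).mul_const _), integral_mul_const, integral_mul_const, integral_const_mul]
  have := discrim_le_zero h
  rw [discrim] at this
  simp only [hT] at this ⊢
  nlinarith

lemma one_sub_half_rpow_sq_le (m : ℕ) :
    1 - (((1 / 2 : ℝ) ^ ((1 / 2 : ℝ) ^ m)) ^ 2) ≤ 2 * (1 / 2 : ℝ) ^ m := by
  have h : (((1 / 2 : ℝ) ^ ((1 / 2 : ℝ) ^ m)) ^ 2) = Real.exp (-(Real.log 2 * (2 * (1 / 2 : ℝ) ^ m))) := by
    rw [Real.rpow_def_of_pos (by norm_num), ← Real.exp_nat_mul]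
    congr 1
    rw [one_div, Real.log_inv]
    push_cast
    ring
  rw [h]
  have h1 := Real.add_one_le_exp (-(Real.log 2 * (2 * (1 / 2 : ℝ) ^ m)))
  have h2 : Real.log 2 ≤ 1 := Real.log_two_lt_d9.le.trans (by norm_num)
  have h3 : (0 : ℝ) ≤ 2 * (1 / 2 : ℝ) ^ m := by positivity
  nlinarith

lemma exp_neg_two_mul_le_one_sub {r : ℝ} (h0 : 0 ≤ r) (h1 : r ≤ 1 / 2) :
    Real.exp (-(2 * r)) ≤ 1 - r := by
  have h2 : 1 + 2 * r ≤ Real.exp (2 * r) := by linarith [Real.add_one_le_exp (2 * r)]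
  rw [Real.exp_neg]
  refine (inv_anti₀ (by linarith) h2).trans ?_
  rw [inv_le_iff_one_le_mul₀ (by linarith)]
  nlinarith

/-- Lower bound for the noise correlation at `1 / 2` in terms of the small noise behaviour. -/
lemma noiseCorr_half_ge (hμ : μ[id] = 0) {g : E → ℝ} (hg : MemLp g 2 μ)
    (hV : 0 < ∫ x, g x ^ 2 ∂μ) {D K : ℝ} (hD : 0 ≤ D) (hK : 0 ≤ K)
    (h : ∀ a b : ℝ, 0 ≤ a → 0 ≤ b → a ^ 2 + b ^ 2 = 1 →
      ∫ p : E × E, (g p.1 - g (a • p.1 + b • p.2)) ^ 2 ∂(μ.prod μ) ≤ 2 * (b ^ 2 * D + b ^ 4 * K)) :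
    (∫ x, g x ^ 2 ∂μ) * Real.exp (-(4 * D / ∫ x, g x ^ 2 ∂μ)) ≤ noiseCorr μ g (1 / 2) √(3 / 4) := by
  set V := ∫ x, g x ^ 2 ∂μ with hVdef
  set a : ℕ → ℝ := fun m => (1 / 2 : ℝ) ^ ((1 / 2 : ℝ) ^ m) with ha
  set b : ℕ → ℝ := fun m => √(1 - a m ^ 2) with hb
  have ha0 (m) : 0 < a m := by positivity
  have ha1 (m) : a m < 1 := Real.rpow_lt_one (by norm_num) (by norm_num) (by positivity)
  have ha2 (m) : 0 < 1 - a m ^ 2 := by nlinarith [ha0 m, ha1 m]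
  have hbsq (m) : b m ^ 2 = 1 - a m ^ 2 := Real.sq_sqrt (ha2 m).le
  have hb0 (m) : 0 < b m := Real.sqrt_pos.2 (ha2 m)
  have hab (m) : a m ^ 2 + b m ^ 2 = 1 := by rw [hbsq]; ring
  have hsucc (m) : a (m + 1) ^ 2 = a m := by
    simp only [ha]
    rw [← Real.rpow_natCast, ← Real.rpow_mul (by norm_num), pow_succ]
    congr 1
    push_cast
    ring
  set Q : ℕ → ℝ := fun m => noiseCorr μ g (a m) (b m) with hQ
  have hstep (m) : Q (m + 1) ^ 2 ≤ Q m * V := by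
    have := noiseCorr_sq_le hμ (hab (m + 1)) (c := b m) (by rw [hsucc]; exact hab m) (hb0 m).ne' hg
    rwa [hsucc] at this
  have hlow (m) : V - (b m ^ 2 * D + b m ^ 4 * K) ≤ Q m := by
    have h1 := h (a m) (b m) (ha0 m).le (hb0 m).le (hab m)
    rw [integral_sub_noise_sq hμ (hab m) hg] at h1
    simp only [hQ]
    linarith
  have hpow (m) (hpos : 0 ≤ Q m) : V * (Q m / V) ^ (2 ^ m) ≤ Q 0 := by
    induction m with
    | zero => simp [mul_div_cancel₀ _ hV.ne']
    | succ m ih =>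
      have h1 : (Q (m + 1) / V) ^ 2 ≤ Q m / V := by
        rw [div_pow, div_le_div_iff₀ (by positivity) hV]
        nlinarith [hstep m]
      have h2 : 0 ≤ Q m := by
        have := (sq_nonneg (Q (m + 1) / V)).trans h1
        rw [le_div_iff₀ hV] at this
        linarith
      refine le_trans ?_ (ih h2)
      rw [pow_succ', pow_mul]
      gcongr
  have hQ0 : Q 0 = noiseCorr μ g (1 / 2) √(3 / 4) := by
    simp only [hQ, hb, ha]
    norm_num
  rw [← hQ0]
  have hbm (m) : b m ^ 2 ≤ 2 * (1 / 2 : ℝ) ^ m := by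
    rw [hbsq]
    exact one_sub_half_rpow_sq_le m
  have hlim0 : Filter.Tendsto (fun m : ℕ => (1 / 2 : ℝ) ^ m) Filter.atTop (nhds 0) :=
    tendsto_pow_atTop_nhds_zero_of_lt_one (by norm_num) (by norm_num)
  have hlim : Filter.Tendsto (fun m : ℕ => V * Real.exp (-(4 * D / V) - 8 * K / V * (1 / 2 : ℝ) ^ m))
      Filter.atTop (nhds (V * Real.exp (-(4 * D / V)))) := by
    have : Filter.Tendsto (fun m : ℕ => -(4 * D / V) - 8 * K / V * (1 / 2 : ℝ) ^ m) Filter.atTop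
        (nhds (-(4 * D / V) - 8 * K / V * 0)) := (hlim0.const_mul _).const_sub _
    rw [mul_zero, sub_zero] at this
    exact ((Real.continuous_exp.tendsto _).comp this).const_mul V
  refine le_of_tendsto hlim ?_
  have hsmall : ∀ᶠ m : ℕ in Filter.atTop,
      (2 * D + 4 * K) / V * (1 / 2 : ℝ) ^ m ≤ 1 / 2 := by
    have := hlim0.const_mul ((2 * D + 4 * K) / V)
    rw [mul_zero] at this
    exact this.eventually_le_const (by norm_num)
  filter_upwards [hsmall] with m hm
  set q : ℝ := (1 / 2 : ℝ) ^ m with hq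
  have hq0 : 0 < q := by positivity
  have hq1 : q ≤ 1 := pow_le_one₀ (by norm_num) (by norm_num)
  set r := (2 * D / V) * q + (4 * K / V) * q ^ 2 with hr
  have hr0 : 0 ≤ r := by positivity
  have hr1 : r ≤ 1 / 2 := by
    refine le_trans ?_ hm
    have : (4 * K / V) * q ^ 2 ≤ (4 * K / V) * q := by
      gcongr
      nlinarith
    rw [add_div]
    rw [hr]
    linarith
  have hQr : 1 - r ≤ Q m / V := by
    rw [le_div_iff₀ hV]
    refine le_trans ?_ (hlow m)
    have e : (1 - r) * V = V - (2 * q * D + (2 * q) ^ 2 * K) := by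
      rw [hr]
      field_simp
      ring
    rw [e]
    have := hbm m
    have h4 : b m ^ 4 ≤ (2 * q) ^ 2 := by
      have : b m ^ 4 = (b m ^ 2) ^ 2 := by ring
      rw [this]
      gcongr
    gcongr
  have hQm : 0 ≤ Q m := by
    have : 0 ≤ Q m / V := le_trans (by linarith) hQr
    rw [le_div_iff₀ hV] at this
    linarith
  refine le_trans ?_ (hpow m hQm)
  have h5 : Real.exp (-(2 * r)) ≤ Q m / V := (exp_neg_two_mul_le_one_sub hr0 hr1).trans hQr
  have h6 : Real.exp (-(2 * r)) ^ (2 ^ m) ≤ (Q m / V) ^ (2 ^ m) := by gcongr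
  refine le_trans (le_of_eq ?_) (mul_le_mul_of_nonneg_left h6 hV.le)
  rw [← Real.exp_nat_mul]
  congr 2
  have : ((2 ^ m : ℕ) : ℝ) * q = 1 := by
    rw [hq]
    push_cast
    rw [← mul_pow]
    norm_num
  rw [hr]
  linear_combination (-(4 * D / V) - 8 * K / V * q) * (- this)

end NoiseCorrelation

section Seminorm

variable {E : Type*} [NormedAddCommGroup E] [NormedSpace ℝ E] [MeasurableSpace E] [BorelSpace E]
  [SecondCountableTopology E] [CompleteSpace E] {μ : Measure E} [IsGaussian μ] {N : E → ℝ}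

lemma MeasureTheory.MemLp.integrable_pow_four {α : Type*} [MeasurableSpace α] {ν : Measure α}
    {f : α → ℝ} (hf : MemLp f 4 ν) : Integrable (fun x => f x ^ 4) ν := by
  have h := hf.integrable_norm_pow (p := 4) (by norm_num)
  refine h.congr (Filter.Eventually.of_forall fun x => ?_)
  simp only [Real.norm_eq_abs]
  exact Even.pow_abs (by decide) _

lemma integral_linear_form_sq_le (hμ : μ[id] = 0) {ℓ : E →L[ℝ] ℝ} {B2 : ℝ}
    (hℓ2 : MemLp ℓ 2 μ) (hB : ∫ x, ℓ x ^ 2 ∂μ ≤ B2) (α β : ℝ) :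
    Integrable (fun w => (α - β * ℓ w) ^ 2) μ ∧
      ∫ w, (α - β * ℓ w) ^ 2 ∂μ ≤ α ^ 2 + β ^ 2 * B2 := by
  have hi : Integrable (fun x => ℓ x) μ := hℓ2.integrable one_le_two
  have h0 : ∫ x, ℓ x ∂μ = 0 := by
    have := ℓ.integral_comp_comm (φ := id) (μ := μ) IsGaussian.integrable_id
    rw [hμ, map_zero] at this
    exact this
  have e : ∀ w, (α - β * ℓ w) ^ 2 = (α ^ 2 + β ^ 2 * ℓ w ^ 2) - (2 * α * β) * ℓ w :=
    fun w => by ring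
  have i1 : Integrable (fun w => α ^ 2 + β ^ 2 * ℓ w ^ 2) μ :=
    (integrable_const _).add (hℓ2.integrable_sq.const_mul _)
  simp_rw [e]
  refine ⟨i1.sub (hi.const_mul _), ?_⟩
  rw [integral_sub i1 (hi.const_mul _), integral_add (integrable_const _)
    (hℓ2.integrable_sq.const_mul _), integral_const_mul, integral_const_mul, h0]
  simp only [integral_const, probReal_univ, smul_eq_mul, one_mul, mul_zero, sub_zero]
  gcongr

lemma seminorm_nonneg (hadd : ∀ x y, N (x + y) ≤ N x + N y)
    (hsmul : ∀ (r : ℝ) x, N (r • x) = |r| * N x) (x : E) : 0 ≤ N x := by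
  have h1 := hadd x ((-1 : ℝ) • x)
  have h2 := hsmul 0 x
  rw [hsmul] at h1
  simp at h1 h2
  rw [h2] at h1
  linarith

lemma integral_small_noise_sq_le (hμ : μ[id] = 0) (hadd : ∀ x y, N (x + y) ≤ N x + N y)
    (hsmul : ∀ (r : ℝ) x, N (r • x) = |r| * N x) (hcont : Continuous N) (hN4 : MemLp N 4 μ)
    {B2 : ℝ} (hsub : ∀ v, ∃ ℓ : E →L[ℝ] ℝ, (∀ x, ℓ x ≤ N x) ∧ ℓ v = N v ∧ ∫ x, ℓ x ^ 2 ∂μ ≤ B2)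
    {φ : ℝ → ℝ} (hφ : LipschitzWith 1 φ) {J : Set ℝ} (hJ : MeasurableSet J) {η : ℝ} (hη : 0 < η)
    (hφJ : ∀ a b, a < b → φ a ≠ φ b → b ∈ J ∨ η < b - a) :
    ∃ K ≥ 0, ∀ a b : ℝ, 0 ≤ a → 0 ≤ b → a ^ 2 + b ^ 2 = 1 →
      ∫ p : E × E, (φ (N p.1) - φ (N (a • p.1 + b • p.2))) ^ 2 ∂(μ.prod μ)
        ≤ 2 * (b ^ 2 * (B2 * μ.real {x | N x ∈ J}) + b ^ 4 * K) := by
  have hN0 := seminorm_nonneg hadd hsmul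
  have hN2 : MemLp N 2 μ := hN4.mono_exponent (by norm_num)
  have m1 : MemLp (fun p : E × E => N p.1) 4 (μ.prod μ) :=
    hN4.comp_measurePreserving measurePreserving_fst
  have m2 : MemLp (fun p : E × E => N p.2) 4 (μ.prod μ) :=
    hN4.comp_measurePreserving measurePreserving_snd
  have m12 : Integrable (fun p : E × E => (N p.1 + N p.2) ^ 4) (μ.prod μ) :=
    (m1.add m2).integrable_pow_four
  have hNm : Measurable N := hcont.measurable
  have hφm : Measurable φ := hφ.continuous.measurable
  refine ⟨∫ x, N x ^ 2 ∂μ + (∫ p : E × E, (N p.1 + N p.2) ^ 4 ∂(μ.prod μ)) / η ^ 2,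
    add_nonneg (integral_nonneg fun x => sq_nonneg _)
      (div_nonneg (integral_nonneg fun x => by positivity) (sq_nonneg _)), ?_⟩
  intro a b ha hb hab
  have ha1 : a ≤ 1 := by nlinarith
  have hb1 : b ≤ 1 := by nlinarith
  have hab' : 1 - a ≤ b ^ 2 := by nlinarith
  set u : E × E → E := fun p => a • p.1 + b • p.2 with hu
  have hum : Measurable u := by fun_prop
  have mu : MemLp (fun p : E × E => N (u p)) 4 (μ.prod μ) :=
    hN4.comp_measurePreserving (measurePreserving_linearComb hμ hab)
  set d : E × E → ℝ := fun p => N p.1 - N (u p) with hd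
  have hdm : Measurable d := by fun_prop
  have md : MemLp d 2 (μ.prod μ) := (m1.sub mu).mono_exponent (by norm_num)
  set F : E × E → ℝ := fun p => (φ (N p.1) - φ (N (u p))) ^ 2 with hF
  have hFm : Measurable F := by fun_prop
  have hFd (p) : F p ≤ d p ^ 2 := by
    have := hφ.dist_le_mul (N p.1) (N (u p))
    rw [NNReal.coe_one, one_mul, Real.dist_eq, Real.dist_eq] at this
    exact sq_le_sq.2 this
  have hFi : Integrable F (μ.prod μ) := by
    refine md.integrable_sq.mono' hFm.aestronglyMeasurable (Filter.Eventually.of_forall fun p => ?_)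
    rw [Real.norm_of_nonneg (sq_nonneg _)]
    exact hFd p
  set A : Set (E × E) := {p | 0 < d p} with hA
  have hAm : MeasurableSet A := measurableSet_lt measurable_const hdm
  have hR := measurePreserving_reflection hμ hab
  set R : E × E → E × E := fun p => (a • p.1 + b • p.2, b • p.1 - a • p.2) with hRdef
  have huR (p) : u (R p) = p.1 := by
    simp only [hu, hRdef]
    match_scalars
    · linear_combination hab
    · ring
  have hdR (p) : d (R p) = - d p := by
    simp only [hd, huR]
    simp only [hRdef, hu]
    ring
  have hFR (p) : F (R p) = F p := by
    simp only [hF, huR]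
    simp only [hRdef, hu]
    ring
  have hsplit : ∫ p, F p ∂(μ.prod μ) = 2 * ∫ p, A.indicator F p ∂(μ.prod μ) := by
    have hi := hFi.indicator hAm
    have e := hR.integral_comp_of_aestronglyMeasurable hi.aestronglyMeasurable
    have hiR : Integrable (fun p => A.indicator F (R p)) (μ.prod μ) :=
      (hR.integrable_comp hi.aestronglyMeasurable).2 hi
    rw [two_mul]
    nth_rewrite 2 [← e]
    rw [← integral_add hi hiR]
    congr with p
    simp only [Set.indicator, hA, Set.mem_ofPred_eq]
    change F p = (if 0 < d p then F p else 0) + (if 0 < d (R p) then F (R p) else 0)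
    rw [hdR, hFR]
    rcases lt_trichotomy (d p) 0 with h | h | h
    · simp [h, h.not_gt]
    · have : F p = 0 := by
        have h2 := hFd p
        rw [h] at h2
        exact le_antisymm (by simpa using h2) (sq_nonneg _)
      simp [this]
    · simp [h, h.not_gt]
  change ∫ p, F p ∂(μ.prod μ) ≤ _
  rw [hsplit]
  refine mul_le_mul_of_nonneg_left ?_ zero_le_two
  set P : Set (E × E) := {p | N p.1 ∈ J} ∩ A with hP
  have hPm : MeasurableSet P := ((hNm.comp measurable_fst) hJ).inter hAm
  have hd_le (p : E × E) : d p ≤ b * (N p.1 + N p.2) := by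
    have h1 : N p.1 ≤ N (u p) + N ((1 - a) • p.1 + (-b) • p.2) := by
      have := hadd (u p) ((1 - a) • p.1 + (-b) • p.2)
      convert this using 2
      simp only [hu]
      match_scalars <;> ring
    have h2 := hadd ((1 - a) • p.1) ((-b) • p.2)
    rw [hsmul, hsmul, abs_of_nonneg (by linarith), abs_neg, abs_of_nonneg hb] at h2
    have h3 : (1 - a) * N p.1 ≤ b * N p.1 :=
      mul_le_mul_of_nonneg_right (by nlinarith) (hN0 _)
    simp only [hd]
    linarith
  have hpt (p) : A.indicator F p ≤ P.indicator (fun p => d p ^ 2) p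
      + b ^ 4 * ((N p.1 + N p.2) ^ 4 / η ^ 2) := by
    have h0 : 0 ≤ b ^ 4 * ((N p.1 + N p.2) ^ 4 / η ^ 2) := by positivity
    by_cases hpA : p ∈ A
    · rw [Set.indicator_of_mem hpA]
      have hpd : 0 < d p := hpA
      by_cases hφe : φ (N (u p)) = φ (N p.1)
      · have : F p = 0 := by simp [hF, hφe]
        rw [this]
        exact add_nonneg (Set.indicator_nonneg (fun _ _ => sq_nonneg _) _) h0
      · rcases hφJ _ _ (by simpa [hd] using hpd) hφe with h | h
        · have : p ∈ P := ⟨h, hpA⟩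
          rw [Set.indicator_of_mem this]
          linarith [hFd p]
        · have h4 : d p ^ 2 ≤ d p ^ 4 / η ^ 2 := by
            rw [le_div_iff₀ (by positivity)]
            have : η ^ 2 ≤ d p ^ 2 := by
              have : η < d p := h
              gcongr
            nlinarith [sq_nonneg (d p)]
          have h5 : d p ^ 4 / η ^ 2 ≤ b ^ 4 * ((N p.1 + N p.2) ^ 4 / η ^ 2) := by
            rw [← mul_div_assoc, ← mul_pow]
            gcongr
            exact hd_le p
          have h6 : 0 ≤ P.indicator (fun p => d p ^ 2) p :=
            Set.indicator_nonneg (fun _ _ => sq_nonneg _) _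
          linarith [hFd p]
    · rw [Set.indicator_of_notMem hpA]
      exact add_nonneg (Set.indicator_nonneg (fun _ _ => sq_nonneg _) _) h0
  have hPi : Integrable (P.indicator (fun p => d p ^ 2)) (μ.prod μ) :=
    md.integrable_sq.indicator hPm
  have hsec (v : E) : ∫ w, P.indicator (fun p => d p ^ 2) (v, w) ∂μ
      ≤ {x | N x ∈ J}.indicator (fun x => (1 - a) ^ 2 * N x ^ 2 + b ^ 2 * B2) v := by
    by_cases hv : N v ∈ J
    · rw [Set.indicator_of_mem (by exact hv)]
      obtain ⟨ℓ, h1, h2, h3⟩ := hsub v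
      have hℓ2 : MemLp ℓ 2 μ := by
        refine hN2.mono ℓ.continuous.aestronglyMeasurable (Filter.Eventually.of_forall fun x => ?_)
        rw [Real.norm_of_nonneg (hN0 x), Real.norm_eq_abs, abs_le]
        have h4 := h1 ((-1 : ℝ) • x)
        rw [hsmul, map_smul] at h4
        simp at h4
        exact ⟨by linarith, h1 x⟩
      obtain ⟨hi, hle⟩ := integral_linear_form_sq_le hμ hℓ2 h3 ((1 - a) * N v) b
      rw [mul_pow] at hle
      refine le_trans (integral_mono_of_nonneg (Filter.Eventually.of_forall fun w =>
        Set.indicator_nonneg (fun _ _ => sq_nonneg _) _) hi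
        (Filter.Eventually.of_forall fun w => ?_)) hle
      refine Set.indicator_le_indicator' (s := P) (g := fun p => ((1 - a) * N v - b * ℓ p.2) ^ 2) (a := (v, w)) ?_ |>.trans ?_
      · rintro ⟨-, hp⟩
        have hp' : 0 < d (v, w) := hp
        have h5 := h1 (u (v, w))
        simp only [hu, map_add, map_smul, smul_eq_mul, h2] at h5
        have h6 : d (v, w) ≤ (1 - a) * N v - b * ℓ w := by
          simp only [hd, hu]
          linarith
        simp only
        gcongr
      · exact Set.indicator_le_self' (fun _ _ => sq_nonneg _) _
    · rw [Set.indicator_of_notMem (by exact hv)]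
      have : ∀ w, P.indicator (fun p => d p ^ 2) (v, w) = 0 := fun w =>
        Set.indicator_of_notMem (fun h => hv h.1) _
      simp [this]
  have hJm : MeasurableSet {x | N x ∈ J} := hNm hJ
  have i4 : Integrable (fun x => (1 - a) ^ 2 * N x ^ 2) μ := hN2.integrable_sq.const_mul _
  have hPint : ∫ p, P.indicator (fun p => d p ^ 2) p ∂(μ.prod μ)
      ≤ b ^ 4 * ∫ x, N x ^ 2 ∂μ + b ^ 2 * (B2 * μ.real {x | N x ∈ J}) := by
    rw [integral_prod _ hPi]
    refine (integral_mono hPi.integral_prod_left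
      ((i4.add (integrable_const (b ^ 2 * B2))).indicator hJm) hsec).trans ?_
    rw [integral_indicator hJm]
    have e : ∫ x in {x | N x ∈ J}, ((1 - a) ^ 2 * N x ^ 2 + b ^ 2 * B2) ∂μ
        = (1 - a) ^ 2 * ∫ x in {x | N x ∈ J}, N x ^ 2 ∂μ + b ^ 2 * (B2 * μ.real {x | N x ∈ J}) := by
      rw [integral_add i4.integrableOn (integrable_const _).integrableOn, integral_const_mul,
        setIntegral_const, smul_eq_mul]
      ring
    refine (le_of_eq e).trans ?_
    have h7 : ∫ x in {x | N x ∈ J}, N x ^ 2 ∂μ ≤ ∫ x, N x ^ 2 ∂μ :=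
      setIntegral_le_integral hN2.integrable_sq (Filter.Eventually.of_forall fun x => sq_nonneg _)
    have h8 : (1 - a) ^ 2 ≤ b ^ 4 := by
      have : b ^ 4 = (b ^ 2) ^ 2 := by ring
      rw [this]
      gcongr
    have h9 : 0 ≤ ∫ x in {x | N x ∈ J}, N x ^ 2 ∂μ := integral_nonneg fun x => sq_nonneg _
    have h10 : (1 - a) ^ 2 * ∫ x in {x | N x ∈ J}, N x ^ 2 ∂μ ≤ b ^ 4 * ∫ x, N x ^ 2 ∂μ := by
      gcongr
    linarith
  have i5 : Integrable (fun p : E × E => b ^ 4 * ((N p.1 + N p.2) ^ 4 / η ^ 2)) (μ.prod μ) :=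
    (m12.div_const _).const_mul _
  have hfin := integral_mono (hFi.indicator hAm) (hPi.add i5) hpt
  rw [integral_add' hPi i5, integral_const_mul, integral_div] at hfin
  linarith

end Seminorm

section Fernique

variable {E : Type*} [NormedAddCommGroup E] [NormedSpace ℝ E] [MeasurableSpace E] [BorelSpace E]
  [SecondCountableTopology E] [CompleteSpace E] {μ : Measure E} [IsGaussian μ] {N : E → ℝ}

lemma seminorm_rotation_tail_le (hμ : μ[id] = 0) (hadd : ∀ x y, N (x + y) ≤ N x + N y)
    (hsmul : ∀ (r : ℝ) x, N (r • x) = |r| * N x) (hcont : Continuous N) (a b : ℝ) :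
    μ.real {x | N x ≤ a} * μ.real {x | b < N x} ≤ μ.real {x | (√2)⁻¹ * (b - a) < N x} ^ 2 := by
  have hNm := hcont.measurable
  set r : ℝ := (√2)⁻¹ with hr
  have hr0 : 0 < r := by positivity
  have hrr : r * r + r * r = 1 := by
    have := sq_sqrt_two_inv
    rwa [sq] at this
  clear_value r
  have hR := measurePreserving_reflection hμ (a := r) (b := r) (by rw [sq, hrr])
  have hS : MeasurableSet ({x | b < N x} ×ˢ {x | N x ≤ a}) :=
    (measurableSet_lt measurable_const hNm).prod (measurableSet_le hNm measurable_const)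
  rw [mul_comm, ← measureReal_prod_prod, ← hR.measureReal_preimage hS.nullMeasurableSet, sq,
    ← measureReal_prod_prod]
  refine measureReal_mono ?_
  rintro ⟨x, y⟩ ⟨h1, h2⟩
  simp only [Set.mem_ofPred_eq] at h1 h2
  have key : ∀ v w : E, N v - N w ≤ N (v + w) := fun v w => by
    have h := hadd (v + w) ((-1 : ℝ) • w)
    rw [hsmul] at h
    simp at h
    linarith
  have key2 : ∀ v w : E, N v - N w ≤ N (v - w) := fun v w => by
    have h := hadd (v - w) w
    simp at h
    linarith
  set v := r • x + r • y
  set w := r • x - r • y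
  have hx : x = r • (v + w) := by
    simp only [v, w]
    match_scalars <;> first | ring1 | linear_combination (-1 : ℝ) * hrr
  have hy : y = r • (v - w) := by
    simp only [v, w]
    match_scalars <;> first | ring1 | linear_combination (-1 : ℝ) * hrr
  constructor
  · simp only [Set.mem_ofPred_eq]
    rw [hx, hsmul, abs_of_pos hr0]
    have := key v w
    gcongr
    linarith
  · simp only [Set.mem_ofPred_eq]
    rw [hy, hsmul, abs_of_pos hr0]
    have := key2 v w
    gcongr
    linarith

/-- A Fernique-type tail estimate with an explicit starting probability. -/
lemma seminorm_tail_le (hμ : μ[id] = 0) (hadd : ∀ x y, N (x + y) ≤ N x + N y)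
    (hsmul : ∀ (r : ℝ) x, N (r • x) = |r| * N x) (hcont : Continuous N) (hint : Integrable N μ)
    (hN1 : ∫ x, N x ∂μ = 1) {l : ℝ} (hl : 0 ≤ l)
    (h11 : (10 / 9) * μ.real {x | 11 < N x} ≤ Real.exp (-l)) {t : ℝ} (ht : 36 ≤ t) :
    μ.real {x | t < N x} ≤ Real.exp (-(l * t ^ 2 / 2592)) := by
  have hN0 := seminorm_nonneg hadd hsmul
  have hNm := hcont.measurable
  have h10 : 9 / 10 ≤ μ.real {x | N x ≤ 10} := by
    have h := mul_meas_ge_le_integral_of_nonneg (Filter.Eventually.of_forall hN0) hint 10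
    rw [hN1] at h
    have h2 : μ.real {x | N x ≤ 10} = 1 - μ.real {x | 10 < N x} := by
      rw [← probReal_compl_eq_one_sub (measurableSet_lt measurable_const hNm)]
      congr 1
      ext x
      simp
    have h3 : μ.real {x | 10 < N x} ≤ μ.real {x | 10 ≤ N x} :=
      measureReal_mono fun x (hx : 10 < N x) => hx.le
    linarith
  set s : ℝ := √2 with hs
  have hs2 : s * s = 2 := Real.mul_self_sqrt (by norm_num)
  have hs0 : 0 < s := by positivity
  have hs1 : 1.4 ≤ s := Real.le_sqrt_of_sq_le (by norm_num)
  have hs15 : s ≤ 1.5 := by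
    rw [hs, Real.sqrt_le_left (by norm_num)]
    norm_num
  set x : ℕ → ℝ := fun m => s ^ m * (21 + 10 * s) - 10 * (s + 1) with hx
  have hx0 : x 0 = 11 := by simp [hx]; ring
  have hxs (m) : s⁻¹ * (x (m + 1) - 10) = x m := by
    rw [inv_mul_eq_iff_eq_mul₀ hs0.ne']
    simp only [hx, pow_succ]
    linear_combination 10 * hs2
  have hrec (m) : (10 / 9) * μ.real {y | x m < N y} ≤ Real.exp (-(l * 2 ^ m)) := by
    induction m with
    | zero => rw [hx0]; simpa using h11
    | succ m ih =>
      have h := seminorm_rotation_tail_le hμ hadd hsmul hcont 10 (x (m + 1))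
      rw [← hs, hxs] at h
      have h1 : 0 ≤ μ.real {y | x (m + 1) < N y} := measureReal_nonneg
      have h2 : 0 ≤ μ.real {y | x m < N y} := measureReal_nonneg
      have h3 : (10 / 9) * μ.real {y | x (m + 1) < N y} ≤ ((10 / 9) * μ.real {y | x m < N y}) ^ 2 := by
        nlinarith
      refine h3.trans ((pow_le_pow_left₀ (by positivity) ih 2).trans (le_of_eq ?_))
      rw [← Real.exp_nat_mul]
      congr 1
      push_cast
      ring
  obtain ⟨m, hm1, hm2⟩ := exists_nat_pow_near (x := t / 36) (y := s)
    ((one_le_div (by norm_num)).2 ht) (by linarith)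
  rw [le_div_iff₀ (by norm_num)] at hm1
  rw [div_lt_iff₀ (by norm_num)] at hm2
  have hsp : 0 < s ^ m := by positivity
  have hxm : x m ≤ t := by
    simp only [hx]
    nlinarith
  have h1 : μ.real {y | t < N y} ≤ μ.real {y | x m < N y} :=
    measureReal_mono fun y (hy : t < N y) => lt_of_le_of_lt hxm hy
  have h2 : 0 ≤ μ.real {y | x m < N y} := measureReal_nonneg
  have h3 : t ^ 2 / 2592 ≤ 2 ^ m := by
    have : t ^ 2 ≤ (s ^ (m + 1) * 36) ^ 2 := by gcongr
    have h4 : (s ^ (m + 1) * 36) ^ 2 = 2592 * 2 ^ m := by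
      rw [mul_pow, ← pow_mul, mul_comm (m + 1) 2, pow_mul, sq s, hs2]
      ring
    rw [h4] at this
    linarith
  have h5 : Real.exp (-(l * 2 ^ m)) ≤ Real.exp (-(l * t ^ 2 / 2592)) := by
    rw [Real.exp_le_exp, mul_div_assoc]
    nlinarith [mul_le_mul_of_nonneg_left h3 hl]
  linarith [hrec m]

end Fernique

section StdGaussian

variable {n : ℕ}

instance instIsProbabilityMeasureStdGaussian : IsProbabilityMeasure (_root_.stdGaussian n) := by
  unfold _root_.stdGaussian
  infer_instance

instance instIsGaussianStdGaussian : IsGaussian (_root_.stdGaussian n) := by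
  have h1 : iIndepFun (fun (i : Fin n) (x : Fin n → ℝ) => x i) (_root_.stdGaussian n) :=
    iIndepFun_pi (μ := fun _ : Fin n => gaussianReal 0 1) (X := fun _ x => x)
      fun i => aemeasurable_id
  have h2 : ∀ i : Fin n, HasGaussianLaw (fun x : Fin n → ℝ => x i) (_root_.stdGaussian n) := by
    intro i
    refine ⟨?_⟩
    have := (measurePreserving_eval (fun _ : Fin n => gaussianReal 0 1) i).map_eq
    change IsGaussian (Measure.map (Function.eval i) (Measure.pi fun _ : Fin n => gaussianReal 0 1))
    rw [this]
    infer_instance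
  have h3 := (h1.hasGaussianLaw h2).isGaussian_map
  rwa [Measure.map_id'] at h3

lemma measurePreserving_eval_stdGaussian (i : Fin n) :
    MeasurePreserving (Function.eval i) (_root_.stdGaussian n) (gaussianReal 0 1) :=
  measurePreserving_eval (fun _ : Fin n => gaussianReal 0 1) i

lemma memLp_eval_stdGaussian (i : Fin n) {p : ENNReal} (hp : p ≠ ⊤) :
    MemLp (fun x : Fin n → ℝ => x i) p (_root_.stdGaussian n) :=
  (IsGaussian.memLp_id (gaussianReal 0 1) p hp).comp_measurePreserving
    (measurePreserving_eval_stdGaussian i)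

lemma integral_id_stdGaussian : (_root_.stdGaussian n)[id] = 0 := by
  ext i
  have h := (ContinuousLinearMap.proj (R := ℝ) (φ := fun _ : Fin n => ℝ) i).integral_comp_comm
    (φ := id) (μ := _root_.stdGaussian n) IsGaussian.integrable_id
  have h2 := (measurePreserving_eval_stdGaussian i).integral_comp_of_aestronglyMeasurable
    (g := fun x => x) (by fun_prop)
  rw [integral_id_gaussianReal] at h2
  exact h.symm.trans h2

lemma integral_linear_stdGaussian (y : Fin n → ℝ) :
    ∫ x, ∑ i, y i * x i ∂(_root_.stdGaussian n) = 0 := by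
  rw [integral_finsetSum]
  · refine Finset.sum_eq_zero fun i _ => ?_
    rw [integral_const_mul]
    have h2 := (measurePreserving_eval_stdGaussian i).integral_comp_of_aestronglyMeasurable
      (g := fun x => x) (by fun_prop)
    rw [integral_id_gaussianReal] at h2
    exact mul_eq_zero_of_right _ h2
  · intro i _
    exact ((memLp_eval_stdGaussian i ENNReal.one_ne_top).integrable le_rfl).const_mul _

lemma variance_linear_stdGaussian (y : Fin n → ℝ) :
    Var[fun x => ∑ i, y i * x i; _root_.stdGaussian n] = ∑ i, y i ^ 2 := by
  have h := variance_sum_pi (μ := fun _ : Fin n => gaussianReal 0 1)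
    (X := fun i x => y i * x) fun i => (IsGaussian.memLp_id _ 2 (by norm_num)).const_mul _
  have e : (∑ i, fun ω : Fin n → ℝ => y i * ω i) = fun x => ∑ i, y i * x i := by
    ext x
    simp
  rw [e] at h
  refine h.trans ?_
  refine Finset.sum_congr rfl fun i _ => ?_
  rw [variance_const_mul]
  have := variance_id_gaussianReal (μ := 0) (v := 1)
  change y i ^ 2 * Var[id; gaussianReal 0 1] = _
  rw [this]
  simp

lemma memLp_linear_stdGaussian (y : Fin n → ℝ) {p : ENNReal} (hp : p ≠ ⊤) :
    MemLp (fun x : Fin n → ℝ => ∑ i, y i * x i) p (_root_.stdGaussian n) :=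
  memLp_finsetSum _ fun i _ => (memLp_eval_stdGaussian i hp).const_mul _

lemma integral_linear_sq_stdGaussian (y : Fin n → ℝ) :
    ∫ x, (∑ i, y i * x i) ^ 2 ∂(_root_.stdGaussian n) = ∑ i, y i ^ 2 := by
  rw [← variance_linear_stdGaussian, variance_of_integral_eq_zero _ (integral_linear_stdGaussian y)]
  exact (memLp_linear_stdGaussian y ENNReal.one_ne_top).aestronglyMeasurable.aemeasurable

/-- The linear form `x ↦ ∑ y i * x i`. -/
noncomputable def coordForm (y : Fin n → ℝ) : (Fin n → ℝ) →L[ℝ] ℝ :=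
  ∑ i, y i • ContinuousLinearMap.proj (R := ℝ) (φ := fun _ : Fin n => ℝ) i

lemma coordForm_apply (y x : Fin n → ℝ) : coordForm y x = ∑ i, y i * x i := by
  simp [coordForm]

lemma map_linear_stdGaussian (y : Fin n → ℝ) :
    (_root_.stdGaussian n).map (fun x => ∑ i, y i * x i)
      = gaussianReal 0 (∑ i, y i ^ 2).toNNReal := by
  have h := IsGaussian.map_eq_gaussianReal (μ := _root_.stdGaussian n) (coordForm y)
  have e : ⇑(coordForm y) = fun x => ∑ i, y i * x i := funext (coordForm_apply y)
  rw [e] at h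
  rw [h, integral_linear_stdGaussian, variance_linear_stdGaussian]

lemma gaussianReal_Ici_three_ge {t : ℝ} (ht : 0 < t) :
    (√(2 * π))⁻¹ * Real.exp (-1) * Real.exp (-(9 / t ^ 2))
      ≤ (gaussianReal 0 (t ^ 2).toNNReal).real (Set.Ici 3) := by
  have hv : (t ^ 2).toNNReal ≠ 0 := by
    simp only [ne_eq, Real.toNNReal_eq_zero, not_le]
    positivity
  have hvt : (((t ^ 2).toNNReal : NNReal) : ℝ) = t ^ 2 := Real.coe_toNNReal _ (by positivity)
  have h1 : (gaussianReal 0 (t ^ 2).toNNReal).real (Set.Icc 3 (3 + t))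
      ≤ (gaussianReal 0 (t ^ 2).toNNReal).real (Set.Ici 3) :=
    measureReal_mono Set.Icc_subset_Ici_self
  refine le_trans ?_ h1
  rw [measureReal_def, gaussianReal_apply_eq_integral _ hv, ENNReal.toReal_ofReal
    (integral_nonneg fun x => gaussianPDFReal_nonneg _ _ _)]
  have h2 : ∫ x in Set.Icc 3 (3 + t), (√(2 * π))⁻¹ * Real.exp (-1) * Real.exp (-(9 / t ^ 2)) / t
      ≤ ∫ x in Set.Icc 3 (3 + t), gaussianPDFReal 0 (t ^ 2).toNNReal x := by
    refine setIntegral_mono_on (by simp) (integrable_gaussianPDFReal _ _).integrableOn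
      measurableSet_Icc fun x hx => ?_
    rw [gaussianPDFReal, hvt, Real.sqrt_mul (x := 2 * π) (by positivity) (t ^ 2), Real.sqrt_sq ht.le, sub_zero, mul_inv,
      mul_assoc, ← Real.exp_add, mul_div_right_comm, div_eq_mul_inv]
    gcongr
    have h3 : x ^ 2 ≤ (3 + t) ^ 2 := by
      have := hx.1
      have := hx.2
      gcongr
    rw [neg_div, ← neg_add, neg_le_neg_iff, div_le_iff₀ (by positivity)]
    have h4 : (1 + 9 / t ^ 2) * (2 * t ^ 2) = 2 * t ^ 2 + 18 := by
      field_simp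
      ring
    rw [h4]
    nlinarith [sq_nonneg (t - 3)]
  refine le_trans (le_of_eq ?_) h2
  rw [setIntegral_const, measureReal_def, Real.volume_Icc]
  simp only [add_sub_cancel_left, smul_eq_mul, ENNReal.toReal_ofReal ht.le]
  field_simp

end StdGaussian

section Unconditional

variable {n : ℕ}

/-- A `1`-unconditional seminorm on `ℝⁿ`. -/
structure IsUncondSeminorm (N : (Fin n → ℝ) → ℝ) : Prop where
  add_le : ∀ x y, N (x + y) ≤ N x + N y
  smul : ∀ (r : ℝ) x, N (r • x) = |r| * N x
  sign : ∀ ε : Fin n → ℝ, (∀ i, ε i = 1 ∨ ε i = -1) → ∀ x, N (fun i => ε i * x i) = N x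

variable {N : (Fin n → ℝ) → ℝ}

namespace IsUncondSeminorm

lemma nonneg (hN : IsUncondSeminorm N) (x : Fin n → ℝ) : 0 ≤ N x :=
  seminorm_nonneg hN.add_le hN.smul x

lemma zero (hN : IsUncondSeminorm N) : N 0 = 0 := by
  have := hN.smul 0 0
  simpa using this

lemma sum_le (hN : IsUncondSeminorm N) {ι : Type*} (s : Finset ι) (f : ι → Fin n → ℝ) :
    N (∑ i ∈ s, f i) ≤ ∑ i ∈ s, N (f i) := by
  classical
  induction s using Finset.induction_on with
  | empty => simp [hN.zero]
  | insert i s hi ih =>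
    rw [Finset.sum_insert hi, Finset.sum_insert hi]
    linarith [hN.add_le (f i) (∑ i ∈ s, f i)]

lemma le_sum_abs (hN : IsUncondSeminorm N) (x : Fin n → ℝ) :
    N x ≤ ∑ i, |x i| * N (Pi.single i 1) := by
  have h := hN.sum_le Finset.univ fun i => x i • (Pi.single i (1 : ℝ) : Fin n → ℝ)
  simp_rw [hN.smul] at h
  refine le_trans (le_of_eq ?_) h
  congr 1
  exact pi_eq_sum_univ' x

lemma le_mul_norm (hN : IsUncondSeminorm N) (x : Fin n → ℝ) :
    N x ≤ (∑ i, N (Pi.single i 1)) * ‖x‖ := by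
  refine (hN.le_sum_abs x).trans ?_
  rw [Finset.sum_mul]
  refine Finset.sum_le_sum fun i _ => ?_
  rw [mul_comm]
  exact mul_le_mul_of_nonneg_left (norm_le_pi_norm x i) (hN.nonneg _)

lemma sub_le (hN : IsUncondSeminorm N) (x y : Fin n → ℝ) : N x - N y ≤ N (x - y) := by
  have := hN.add_le (x - y) y
  rw [sub_add_cancel] at this
  linarith

lemma neg (hN : IsUncondSeminorm N) (x : Fin n → ℝ) : N (-x) = N x := by
  have := hN.smul (-1) x
  simpa using this

lemma continuous (hN : IsUncondSeminorm N) : Continuous N := by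
  have h0 : 0 ≤ ∑ i, N (Pi.single i 1) := Finset.sum_nonneg fun i _ => hN.nonneg _
  refine (LipschitzWith.of_dist_le_mul (K := ⟨∑ i, N (Pi.single i 1), h0⟩) fun x y => ?_).continuous
  rw [Real.dist_eq, dist_eq_norm, abs_le]
  have h1 := hN.sub_le x y
  have h2 := hN.sub_le y x
  rw [← neg_sub x y, hN.neg] at h2
  have h3 := hN.le_mul_norm (x - y)
  constructor
  · change -((∑ i, N (Pi.single i 1)) * ‖x - y‖) ≤ _
    linarith
  · change _ ≤ (∑ i, N (Pi.single i 1)) * ‖x - y‖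
    linarith

lemma memLp (hN : IsUncondSeminorm N) {p : ENNReal} (hp : p ≠ ⊤) :
    MemLp N p (_root_.stdGaussian n) := by
  refine MemLp.of_le_mul (c := ∑ i, N (Pi.single i 1)) (IsGaussian.memLp_id _ p hp)
    hN.continuous.aestronglyMeasurable (Filter.Eventually.of_forall fun x => ?_)
  rw [Real.norm_of_nonneg (hN.nonneg x)]
  exact hN.le_mul_norm x

lemma integrable (hN : IsUncondSeminorm N) : Integrable N (_root_.stdGaussian n) :=
  (hN.memLp ENNReal.one_ne_top).integrable le_rfl

lemma piecewise_zero_le (hN : IsUncondSeminorm N) (S : Finset (Fin n)) (x : Fin n → ℝ) :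
    N (S.piecewise 0 x) ≤ N x := by
  have h1 := hN.sign (S.piecewise (fun _ => -1) (fun _ => 1))
    (fun i => by by_cases hi : i ∈ S <;> simp [hi]) x
  have h2 : S.piecewise 0 x = (1 / 2 : ℝ) • x + (1 / 2 : ℝ) • fun i =>
      (S.piecewise (fun _ => (-1 : ℝ)) (fun _ => 1)) i * x i := by
    ext i
    by_cases hi : i ∈ S
    · simp [hi]
    · simp [hi]
      ring
  rw [h2]
  refine (hN.add_le _ _).trans ?_
  rw [hN.smul, hN.smul, h1, abs_of_pos (by norm_num)]
  linarith

lemma piecewise_half_le (hN : IsUncondSeminorm N) (S : Finset (Fin n)) (x : Fin n → ℝ) :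
    N (S.piecewise ((1 / 2 : ℝ) • x) x) ≤ (1 / 2) * N x + (1 / 2) * N (S.piecewise 0 x) := by
  have h2 : S.piecewise ((1 / 2 : ℝ) • x) x
      = (1 / 2 : ℝ) • x + (1 / 2 : ℝ) • S.piecewise 0 x := by
    ext i
    by_cases hi : i ∈ S
    · simp [hi]
    · simp [hi]
      ring
  rw [h2]
  refine (hN.add_le _ _).trans (le_of_eq ?_)
  rw [hN.smul, hN.smul, abs_of_pos (by norm_num)]

lemma continuous_piecewise_zero (S : Finset (Fin n)) :
    Continuous fun x : Fin n → ℝ => S.piecewise 0 x := by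
  refine continuous_pi fun i => ?_
  by_cases hi : i ∈ S
  · simpa [hi] using continuous_const
  · simpa [hi] using continuous_apply i

lemma comp_piecewise_zero (hN : IsUncondSeminorm N) (S : Finset (Fin n)) :
    IsUncondSeminorm fun x => N (S.piecewise 0 x) := by
  refine ⟨fun x y => ?_, fun r x => ?_, fun ε hε x => ?_⟩
  · refine le_trans (le_of_eq ?_) (hN.add_le _ _)
    congr 1
    ext i
    by_cases hi : i ∈ S <;> simp [hi]
  · rw [← hN.smul]
    congr 1
    ext i
    by_cases hi : i ∈ S <;> simp [hi]
  · rw [← hN.sign ε hε (S.piecewise 0 x)]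
    congr 1
    ext i
    by_cases hi : i ∈ S <;> simp [hi]

/-- In position of minimal `M`, deleting `k` coordinates decreases `E N(G)` by at most a factor
`1 - 2 k / n`. -/
lemma integral_sub_piecewise_le (hN : IsUncondSeminorm N) (hM : MinimalMPosition n N) (hn : 1 ≤ n)
    (S : Finset (Fin n)) :
    ∫ x, (N x - N (S.piecewise 0 x)) ∂(_root_.stdGaussian n)
      ≤ 2 * S.card / n * ∫ x, N x ∂(_root_.stdGaussian n) := by
  have hn0 : (0 : ℝ) < n := by exact_mod_cast hn
  set β : ℝ := Real.exp (Real.log 2 * S.card / n) with hβ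
  have hβ0 : 0 < β := Real.exp_pos _
  have hβn : β ^ n = 2 ^ S.card := by
    rw [hβ, ← Real.exp_nat_mul, mul_div_cancel₀ _ hn0.ne', mul_comm, Real.exp_nat_mul,
      Real.exp_log (by norm_num)]
  set τ : Fin n → ℝ := fun i => β * (if i ∈ S then 1 / 2 else 1) with hτ
  have hdet : LinearMap.det (Matrix.toLin' (Matrix.diagonal τ)) = 1 := by
    rw [LinearMap.det_toLin', Matrix.det_diagonal, Finset.prod_mul_distrib, Finset.prod_const,
      Finset.prod_ite, Finset.prod_const, Finset.prod_const_one, Finset.card_univ, Fintype.card_fin,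
      hβn, Finset.filter_mem_eq_inter, Finset.univ_inter, mul_one, ← mul_pow]
    norm_num
  have h1 := hM _ hdet
  have h2 : ∀ x : Fin n → ℝ, N (Matrix.toLin' (Matrix.diagonal τ) x)
      ≤ β * ((1 / 2) * N x + (1 / 2) * N (S.piecewise 0 x)) := fun x => by
    have e : Matrix.toLin' (Matrix.diagonal τ) x = β • S.piecewise ((1 / 2 : ℝ) • x) x := by
      ext i
      rw [Matrix.toLin'_apply, Matrix.mulVec_diagonal]
      by_cases hi : i ∈ S <;> simp [hτ, hi]
      ring
    rw [e, hN.smul, abs_of_pos hβ0]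
    exact mul_le_mul_of_nonneg_left (hN.piecewise_half_le S x) hβ0.le
  have iN := hN.integrable
  have iS := (hN.comp_piecewise_zero S).integrable
  have h3 : ∫ x, N (Matrix.toLin' (Matrix.diagonal τ) x) ∂(_root_.stdGaussian n)
      ≤ ∫ x, β * ((1 / 2) * N x + (1 / 2) * N (S.piecewise 0 x)) ∂(_root_.stdGaussian n) :=
    integral_mono_of_nonneg (Filter.Eventually.of_forall fun x => hN.nonneg _)
      (((iN.const_mul _).add (iS.const_mul _)).const_mul _) (Filter.Eventually.of_forall h2)
  rw [integral_const_mul, integral_add (iN.const_mul _) (iS.const_mul _), integral_const_mul,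
    integral_const_mul] at h3
  rw [integral_sub iN iS]
  set I := ∫ x, N x ∂(_root_.stdGaussian n)
  set I' := ∫ x, N (S.piecewise 0 x) ∂(_root_.stdGaussian n)
  have hI : 0 ≤ I := integral_nonneg hN.nonneg
  have h4 : (1 - S.card / n) * β ≤ 1 := by
    have h5 : 1 - (S.card / n : ℝ) ≤ Real.exp (-(Real.log 2 * S.card / n)) := by
      have := Real.add_one_le_exp (-(Real.log 2 * S.card / n))
      have h6 : Real.log 2 * S.card / n ≤ S.card / n := by
        have : Real.log 2 ≤ 1 := Real.log_two_lt_d9.le.trans (by norm_num)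
        gcongr
        exact mul_le_of_le_one_left (by positivity) this
      linarith
    rw [Real.exp_neg, ← hβ] at h5
    calc (1 - S.card / n) * β ≤ β⁻¹ * β := by gcongr
      _ = 1 := inv_mul_cancel₀ hβ0.ne'
  have h7 : I ≤ β * (1 / 2 * I + 1 / 2 * I') := h1.trans h3
  have h8 : (1 - S.card / n) * (β * I) ≤ 1 / 2 * (β * I) + 1 / 2 * (β * I') := by
    nlinarith
  have h9 : β * (I - I') ≤ β * (2 * S.card / n * I) := by
    have : (2 * S.card / n : ℝ) = 2 * (S.card / n) := by ring
    rw [this]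
    linarith
  exact le_of_mul_le_mul_left h9 hβ0

lemma exists_supporting (hN : IsUncondSeminorm N) (v : Fin n → ℝ) :
    ∃ y : Fin n → ℝ, (∀ x, ∑ i, y i * x i ≤ N x) ∧ ∑ i, y i * v i = N v := by
  by_cases hv : v = 0
  · exact ⟨0, fun x => by simpa using hN.nonneg x, by simp [hv, hN.zero]⟩
  · obtain ⟨g, hg1, hg2⟩ := exists_extension_of_le_sublinear
      (LinearPMap.mkSpanSingleton v (N v) hv) N
      (fun c hc x => by rw [hN.smul, abs_of_pos hc]) hN.add_le (by
        rintro ⟨x, hx⟩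
        obtain ⟨c, rfl⟩ := Submodule.mem_span_singleton.1 hx
        rw [LinearPMap.mkSpanSingleton'_apply, hN.smul, smul_eq_mul]
        exact mul_le_mul_of_nonneg_right (le_abs_self c) (hN.nonneg v))
    have hgs : ∀ x, ∑ i, g (Pi.single i 1) * x i = g x := fun x => by
      conv_rhs => rw [pi_eq_sum_univ' x]
      rw [map_sum]
      refine Finset.sum_congr rfl fun i _ => ?_
      rw [map_smul, smul_eq_mul, mul_comm]
    refine ⟨fun i => g (Pi.single i 1), fun x => ?_, ?_⟩
    · rw [hgs]
      exact hg2 x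
    · rw [hgs]
      have := hg1 ⟨v, Submodule.mem_span_singleton_self v⟩
      simp only at this
      rw [this]
      exact LinearPMap.mkSpanSingleton_apply ℝ ℝ hv (N v)

lemma sum_abs_mul_le (hN : IsUncondSeminorm N) {y : Fin n → ℝ}
    (hy : ∀ x, ∑ i, y i * x i ≤ N x) (x : Fin n → ℝ) : ∑ i, |y i| * |x i| ≤ N x := by
  set ε : Fin n → ℝ := fun i => if 0 ≤ y i * x i then 1 else -1 with hε
  have h := hy fun i => ε i * x i
  rw [hN.sign ε (fun i => by by_cases h : 0 ≤ y i * x i <;> simp [hε, h])] at h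
  refine le_trans (le_of_eq ?_) h
  refine Finset.sum_congr rfl fun i _ => ?_
  rw [← abs_mul]
  by_cases h : 0 ≤ y i * x i
  · simp [hε, h, abs_of_nonneg h]
  · simp only [hε, h, if_false]
    rw [abs_of_neg (not_le.1 h)]
    ring

end IsUncondSeminorm

end Unconditional

section Marginals

variable {n : ℕ} {N : (Fin n → ℝ) → ℝ}

/-- The first absolute moment of a standard Gaussian variable. -/
noncomputable def gaussianAbsMoment : ℝ := ∫ x, |x| ∂gaussianReal 0 1

lemma integrable_abs_gaussianReal : Integrable (fun x : ℝ => |x|) (gaussianReal 0 1) :=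
  ((memLp_id_gaussianReal 1).integrable le_rfl).abs

lemma gaussianAbsMoment_pos : 0 < gaussianAbsMoment := by
  have h0 : 0 ≤ gaussianAbsMoment := integral_nonneg fun x => abs_nonneg x
  refine h0.lt_of_ne' fun h => ?_
  have h1 := (integral_eq_zero_iff_of_nonneg (fun x => abs_nonneg x)
    integrable_abs_gaussianReal).1 h
  have h2 : variance id (gaussianReal 0 1) = 0 := by
    rw [variance_congr (Y := fun _ => (0 : ℝ)) (by
      filter_upwards [h1] with x hx
      simpa using hx)]
    simp [variance_eq_integral]
  rw [variance_id_gaussianReal] at h2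
  norm_num at h2

lemma integrable_abs_eval_stdGaussian (i : Fin n) :
    Integrable (fun x => |x i|) (_root_.stdGaussian n) :=
  ((memLp_eval_stdGaussian i ENNReal.one_ne_top).integrable le_rfl).abs

lemma integral_abs_eval_stdGaussian (i : Fin n) :
    ∫ x, |x i| ∂(_root_.stdGaussian n) = gaussianAbsMoment :=
  (measurePreserving_eval_stdGaussian i).integral_comp_of_aestronglyMeasurable (g := fun x => |x|)
    integrable_abs_gaussianReal.aestronglyMeasurable

lemma log_le_two_mul_sqrt (x : ℝ) (hx : 0 < x) : Real.log x ≤ 2 * √x := by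
  have h := Real.log_le_sub_one_of_pos (Real.sqrt_pos.2 hx)
  rw [Real.log_sqrt hx.le] at h
  linarith

namespace IsUncondSeminorm

lemma sum_abs_mul_gaussianAbsMoment_le (hN : IsUncondSeminorm N) {y : Fin n → ℝ}
    (hy : ∀ x, ∑ i, y i * x i ≤ N x) :
    (∑ i, |y i|) * gaussianAbsMoment ≤ ∫ x, N x ∂(_root_.stdGaussian n) := by
  have h : ∫ x, ∑ i, |y i| * |x i| ∂(_root_.stdGaussian n) ≤ ∫ x, N x ∂(_root_.stdGaussian n) :=
    integral_mono (integrable_finsetSum _ fun i _ => (integrable_abs_eval_stdGaussian i).const_mul _)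
      hN.integrable fun x => hN.sum_abs_mul_le hy x
  rw [integral_finsetSum _ fun i _ => (integrable_abs_eval_stdGaussian i).const_mul _] at h
  simp_rw [integral_const_mul, integral_abs_eval_stdGaussian] at h
  rwa [Finset.sum_mul]

/-- A partial marginal of a supporting functional exceeds `3` with small probability. -/
lemma measure_marginal_ge_three_le (hN : IsUncondSeminorm N) (hM : MinimalMPosition n N)
    (hn : 1 ≤ n) (hN1 : ∫ x, N x ∂(_root_.stdGaussian n) = 1) {y : Fin n → ℝ}
    (hy : ∀ x, ∑ i, y i * x i ≤ N x) (S : Finset (Fin n)) :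
    (_root_.stdGaussian n).real {x | 3 ≤ ∑ i ∈ S, y i * x i} ≤ 4 * S.card / n := by
  set γ := _root_.stdGaussian n with hγ
  have hS := hN.comp_piecewise_zero S
  set A : Set (Fin n → ℝ) := {x | N (S.piecewise 0 x) < 2} with hA
  set B : Set (Fin n → ℝ) := {x | 3 ≤ ∑ i ∈ S, y i * x i} with hB
  have mA : MeasurableSet A := measurableSet_lt hS.continuous.measurable measurable_const
  have mB : MeasurableSet B := measurableSet_le measurable_const (by fun_prop)
  have hpA : 1 / 2 ≤ γ.real A := by
    have h1 := mul_meas_ge_le_integral_of_nonneg (μ := γ)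
      (Filter.Eventually.of_forall hS.nonneg) hS.integrable 2
    have h2 : ∫ x, N (S.piecewise 0 x) ∂γ ≤ ∫ x, N x ∂γ :=
      integral_mono hS.integrable hN.integrable fun x => hN.piecewise_zero_le S x
    have h3 : {x | 2 ≤ N (S.piecewise 0 x)} = Aᶜ := by
      ext x
      simp [hA]
    rw [h3, probReal_compl_eq_one_sub mA] at h1
    linarith
  have hAB : γ.real (A ∩ B) = γ.real A * γ.real B := by
    have hp : MeasurePreserving (fun p : (Fin n → ℝ) × (Fin n → ℝ) => S.piecewise p.2 p.1)
        (γ.prod γ) γ := measurePreserving_piecewise S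
    rw [← measureReal_prod_prod, ← hp.measureReal_preimage (mA.inter mB).nullMeasurableSet]
    congr 1
    ext p
    have e2 : ∑ i ∈ S, y i * S.piecewise p.2 p.1 i = ∑ i ∈ S, y i * p.2 i :=
      Finset.sum_congr rfl fun i hi => by simp [hi]
    simp [hA, hB, e2]
  have hle : γ.real (A ∩ B) ≤ 2 * S.card / n := by
    have hi := hN.integrable.sub hS.integrable
    have h1 := mul_meas_ge_le_integral_of_nonneg (μ := γ)
      (f := fun x => N x - N (S.piecewise 0 x))
      (Filter.Eventually.of_forall fun x => sub_nonneg.2 (hN.piecewise_zero_le S x)) hi 1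
    have h2 := hN.integral_sub_piecewise_le hM hn S
    rw [hN1, mul_one] at h2
    rw [one_mul] at h1
    refine le_trans ?_ (h1.trans h2)
    refine measureReal_mono (fun x (hx : x ∈ A ∩ B) => ?_)
    have h3 : N (S.piecewise 0 x) < 2 := hx.1
    have h4 : 3 ≤ ∑ i ∈ S, y i * x i := hx.2
    have h5 : ∑ i ∈ S, y i * x i ≤ N x := by
      refine le_trans ?_ (hN.sum_abs_mul_le hy x)
      refine le_trans (Finset.sum_le_sum fun i _ => ?_)
        (Finset.sum_le_sum_of_subset_of_nonneg (Finset.subset_univ S) fun i _ _ => by positivity)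
      rw [← abs_mul]
      exact le_abs_self _
    change 1 ≤ N x - N (S.piecewise 0 x)
    linarith
  rw [hAB] at hle
  have h0 : 0 ≤ γ.real B := measureReal_nonneg
  have : (4 * S.card / n : ℝ) = 2 * (2 * S.card / n) := by ring
  rw [this]
  nlinarith

end IsUncondSeminorm

/-- In position of minimal `M`, the supporting functionals have Euclidean norm `O((log n)^{-1/2})`
relative to `E N(G)`. -/
lemma exists_sum_sq_mul_log_le : ∃ B > (0 : ℝ), ∀ n : ℕ, 1 ≤ n → ∀ N : (Fin n → ℝ) → ℝ,
    IsUncondSeminorm N → MinimalMPosition n N → ∫ x, N x ∂(_root_.stdGaussian n) = 1 →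
    ∀ y : Fin n → ℝ, (∀ x, ∑ i, y i * x i ≤ N x) → (∑ i, y i ^ 2) * Real.log n ≤ B := by
  set a : ℝ := gaussianAbsMoment⁻¹ with ha
  have ha0 : 0 < a := inv_pos.2 gaussianAbsMoment_pos
  set c : ℝ := (√(2 * π))⁻¹ * Real.exp (-1) with hc
  have hc0 : 0 < c := by positivity
  refine ⟨2 * a + (18 + 2 * a ^ 2 * |Real.log (4 * a / c)|), by positivity,
    fun n hn N hN hM hN1 y hy => ?_⟩
  have hn1 : (1 : ℝ) ≤ n := by exact_mod_cast hn
  have hn0 : (0 : ℝ) < n := by linarith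
  have hs0 : 0 < √(n : ℝ) := Real.sqrt_pos.2 hn0
  have hss : √(n : ℝ) * √(n : ℝ) = n := Real.mul_self_sqrt hn0.le
  have hL0 : 0 ≤ Real.log n := Real.log_nonneg hn1
  have h1 : ∑ i, |y i| ≤ a := by
    have := hN.sum_abs_mul_gaussianAbsMoment_le hy
    rw [hN1] at this
    rw [ha, ← one_div, le_div_iff₀ gaussianAbsMoment_pos]
    exact this
  set S : Finset (Fin n) := Finset.univ.filter fun i => 1 ≤ |y i| * √(n : ℝ) with hS
  have hcard : (S.card : ℝ) ≤ a * √(n : ℝ) := by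
    calc (S.card : ℝ) = ∑ i ∈ S, (1 : ℝ) := by simp
      _ ≤ ∑ i ∈ S, |y i| * √(n : ℝ) := Finset.sum_le_sum fun i hi => (Finset.mem_filter.1 hi).2
      _ ≤ ∑ i, |y i| * √(n : ℝ) :=
        Finset.sum_le_sum_of_subset_of_nonneg (Finset.subset_univ S) fun i _ _ => by positivity
      _ ≤ a * √(n : ℝ) := by
        rw [← Finset.sum_mul]
        gcongr
  have hsplit : ∑ i, y i ^ 2 = ∑ i ∈ S, y i ^ 2 + ∑ i ∈ Sᶜ, y i ^ 2 :=
    (Finset.sum_add_sum_compl S _).symm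
  have hcompl : (∑ i ∈ Sᶜ, y i ^ 2) * √(n : ℝ) ≤ a := by
    rw [Finset.sum_mul]
    refine le_trans ?_ h1
    refine le_trans (Finset.sum_le_sum fun i hi => ?_)
      (Finset.sum_le_sum_of_subset_of_nonneg (Finset.subset_univ Sᶜ) fun i _ _ => abs_nonneg (y i))
    have h2 : |y i| * √(n : ℝ) < 1 := by
      rw [Finset.mem_compl, hS, Finset.mem_filter] at hi
      by_contra h
      exact hi ⟨Finset.mem_univ i, not_lt.1 h⟩
    rw [← sq_abs]
    nlinarith [abs_nonneg (y i)]
  have hpart1 : (∑ i ∈ Sᶜ, y i ^ 2) * Real.log n ≤ 2 * a := by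
    have h0 : 0 ≤ ∑ i ∈ Sᶜ, y i ^ 2 := Finset.sum_nonneg fun i _ => sq_nonneg _
    have := mul_le_mul_of_nonneg_left (log_le_two_mul_sqrt n hn0) h0
    linarith
  have hpart2 : (∑ i ∈ S, y i ^ 2) * Real.log n ≤ 18 + 2 * a ^ 2 * |Real.log (4 * a / c)| := by
    set T := ∑ i ∈ S, y i ^ 2 with hT
    have hT0 : 0 ≤ T := Finset.sum_nonneg fun i _ => sq_nonneg _
    have hTa : T ≤ a ^ 2 := by
      calc T ≤ ∑ i, |y i| ^ 2 := by
            simp_rw [sq_abs]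
            exact Finset.sum_le_sum_of_subset_of_nonneg (Finset.subset_univ S)
              fun i _ _ => sq_nonneg _
        _ ≤ (∑ i, |y i|) ^ 2 := Finset.sum_sq_le_sq_sum_of_nonneg fun i _ => abs_nonneg _
        _ ≤ a ^ 2 := pow_le_pow_left₀ (Finset.sum_nonneg fun i _ => abs_nonneg _) h1 2
    rcases hT0.eq_or_lt with h | hTpos
    · rw [← h]
      simp only [zero_mul]
      positivity
    · have hmap : (_root_.stdGaussian n).real {x | 3 ≤ ∑ i ∈ S, y i * x i}
          = (gaussianReal 0 T.toNNReal).real (Set.Ici 3) := by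
        have hm := map_linear_stdGaussian (n := n) (S.piecewise y 0)
        have e1 : ∑ i, (S.piecewise y 0 i) ^ 2 = T := by
          rw [hT, ← Finset.sum_add_sum_compl S]
          rw [Finset.sum_congr rfl (g := fun i => y i ^ 2) fun i hi => by simp [hi],
            Finset.sum_congr rfl (s₁ := Sᶜ) (g := fun i => (0 : ℝ)) fun i hi => by
              simp [Finset.mem_compl.1 hi]]
          simp
        have e2 : ∀ x : Fin n → ℝ, ∑ i, S.piecewise y 0 i * x i = ∑ i ∈ S, y i * x i := fun x => by
          rw [← Finset.sum_add_sum_compl S]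
          rw [Finset.sum_congr rfl (g := fun i => y i * x i) fun i hi => by simp [hi],
            Finset.sum_congr rfl (s₁ := Sᶜ) (g := fun i => (0 : ℝ)) fun i hi => by
              simp [Finset.mem_compl.1 hi]]
          simp
        rw [e1] at hm
        simp_rw [e2] at hm
        rw [← hm, map_measureReal_apply (by fun_prop) measurableSet_Ici]
        rfl
      have h3 := hN.measure_marginal_ge_three_le hM hn hN1 hy S
      have h4 := gaussianReal_Ici_three_ge (Real.sqrt_pos.2 hTpos)
      rw [Real.sq_sqrt hT0, ← hmap, ← hc] at h4
      have h5 : Real.exp (-(9 / T)) ≤ (4 * a / c) / √(n : ℝ) := by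
        have h6 : (4 * S.card / n : ℝ) ≤ 4 * a / √(n : ℝ) := by
          rw [div_le_div_iff₀ hn0 hs0]
          nlinarith
        rw [div_div, mul_comm c, ← div_div, le_div_iff₀ hc0]
        linarith
      have h7 : -(9 / T) ≤ Real.log (4 * a / c) - Real.log n / 2 := by
        have := Real.log_le_log (Real.exp_pos _) h5
        rwa [Real.log_exp, Real.log_div (by positivity) hs0.ne', Real.log_sqrt hn0.le] at this
      have h8 : T * -(9 / T) = -9 := by field_simp
      have h9 := mul_le_mul_of_nonneg_left h7 hT0
      have h10 : T * Real.log (4 * a / c) ≤ a ^ 2 * |Real.log (4 * a / c)| :=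
        (mul_le_mul_of_nonneg_left (le_abs_self _) hT0).trans
          (mul_le_mul_of_nonneg_right hTa (abs_nonneg _))
      rw [h8] at h9
      linarith
  rw [hsplit, add_mul]
  linarith

end Marginals

section RealNoise

variable {E : Type*} [NormedAddCommGroup E] [NormedSpace ℝ E] [MeasurableSpace E] [BorelSpace E]
  [SecondCountableTopology E] [CompleteSpace E] {μ : Measure E} [IsGaussian μ]

lemma integral_noise_sq_le (hμ : μ[id] = 0) {u : E → ℝ} (hu : Measurable u) (hu0 : ∀ x, 0 ≤ u x)
    (hu2 : MemLp u 2 μ) (hs : ∀ x, Integrable (fun z => u ((√2)⁻¹ • x + (√2)⁻¹ • z)) μ) :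
    ∫ x, (∫ z, u ((√2)⁻¹ • x + (√2)⁻¹ • z) ∂μ) ^ 2 ∂μ
      ≤ (∫ x, u x ∂μ) ^ (1 / 2 : ℝ) * (∫ x, u x ^ 2 ∂μ) ^ (3 / 4 : ℝ) := by
  have h := lintegral_noise_sq_le hμ (u := fun x => ENNReal.ofReal (u x)) hu.ennreal_ofReal
  have e1 : ∀ x, ∫⁻ z, ENNReal.ofReal (u ((√2)⁻¹ • x + (√2)⁻¹ • z)) ∂μ
      = ENNReal.ofReal (∫ z, u ((√2)⁻¹ • x + (√2)⁻¹ • z) ∂μ) := fun x =>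
    (ofReal_integral_eq_lintegral_ofReal (hs x) (Filter.Eventually.of_forall fun z => hu0 _)).symm
  have hU0 : ∀ x, 0 ≤ ∫ z, u ((√2)⁻¹ • x + (√2)⁻¹ • z) ∂μ := fun x =>
    integral_nonneg fun z => hu0 _
  have i1 : 0 ≤ ∫ x, u x ∂μ := integral_nonneg hu0
  have i2 : 0 ≤ ∫ x, u x ^ 2 ∂μ := integral_nonneg fun x => sq_nonneg _
  have hm : StronglyMeasurable fun x => ∫ z, u ((√2)⁻¹ • x + (√2)⁻¹ • z) ∂μ := by
    have : StronglyMeasurable fun p : E × E => u ((√2)⁻¹ • p.1 + (√2)⁻¹ • p.2) :=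
      (by fun_prop : Measurable fun p : E × E => u ((√2)⁻¹ • p.1 + (√2)⁻¹ • p.2)).stronglyMeasurable
    exact this.integral_prod_right'
  simp_rw [e1, ← ENNReal.ofReal_pow (hU0 _), ← ENNReal.ofReal_pow (hu0 _)] at h
  rw [← ofReal_integral_eq_lintegral_ofReal (hu2.integrable (by norm_num))
      (Filter.Eventually.of_forall hu0),
    ← ofReal_integral_eq_lintegral_ofReal hu2.integrable_sq
      (Filter.Eventually.of_forall fun x => sq_nonneg _),
    ENNReal.ofReal_rpow_of_nonneg i1 (by norm_num), ENNReal.ofReal_rpow_of_nonneg i2 (by norm_num),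
    ← ENNReal.ofReal_mul (by positivity)] at h
  rw [integral_eq_lintegral_of_nonneg_ae (Filter.Eventually.of_forall fun x => sq_nonneg _)
    (hm.pow 2).aestronglyMeasurable]
  exact ENNReal.toReal_le_of_le_ofReal (by positivity) h

end RealNoise

section Influences

variable {n : ℕ} {N : (Fin n → ℝ) → ℝ}

namespace IsUncondSeminorm

lemma integrable_slice (hN : IsUncondSeminorm N) {f : (Fin n → ℝ) → ℝ} (hf : Continuous f) {c : ℝ}
    (hb : ∀ v, |f v| ≤ c + N v) (a b : ℝ) (x : Fin n → ℝ) :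
    Integrable (fun z => f (a • x + b • z)) (_root_.stdGaussian n) := by
  refine Integrable.mono' (g := fun z => (c + |a| * N x) + |b| * N z)
    ((integrable_const _).add (hN.integrable.const_mul _))
    (by fun_prop : Continuous fun z => f (a • x + b • z)).aestronglyMeasurable
    (Filter.Eventually.of_forall fun z => ?_)
  have := hN.add_le (a • x) (b • z)
  rw [hN.smul, hN.smul] at this
  rw [Real.norm_eq_abs]
  linarith [hb (a • x + b • z)]

lemma abs_noise_le (hN : IsUncondSeminorm N) {f : (Fin n → ℝ) → ℝ} (hf : Continuous f) {c : ℝ}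
    (hb : ∀ v, |f v| ≤ c + N v) (a b : ℝ) (x : Fin n → ℝ) :
    |∫ z, f (a • x + b • z) ∂(_root_.stdGaussian n)|
      ≤ (c + |b| * ∫ z, N z ∂(_root_.stdGaussian n)) + |a| * N x := by
  refine abs_integral_le_integral_abs.trans ?_
  have h1 : ∫ z, |f (a • x + b • z)| ∂(_root_.stdGaussian n)
      ≤ ∫ z, ((c + |a| * N x) + |b| * N z) ∂(_root_.stdGaussian n) := by
    refine integral_mono (hN.integrable_slice hf hb a b x).abs
      ((integrable_const _).add (hN.integrable.const_mul _)) fun z => ?_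
    have h2 := hN.add_le (a • x) (b • z)
    rw [hN.smul, hN.smul] at h2
    have h3 := hb (a • x + b • z)
    change |f (a • x + b • z)| ≤ _
    linarith
  rw [integral_add (integrable_const _) (hN.integrable.const_mul _), integral_const,
    integral_const_mul, probReal_univ, one_smul] at h1
  linarith

lemma memLp_noise (hN : IsUncondSeminorm N) {f : (Fin n → ℝ) → ℝ} (hf : Continuous f) {c : ℝ}
    (hb : ∀ v, |f v| ≤ c + N v) (a b : ℝ) :
    MemLp (fun x => ∫ z, f (a • x + b • z) ∂(_root_.stdGaussian n)) 2 (_root_.stdGaussian n) := by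
  have hm : StronglyMeasurable fun x => ∫ z, f (a • x + b • z) ∂(_root_.stdGaussian n) := by
    have hc : Continuous fun p : (Fin n → ℝ) × (Fin n → ℝ) => f (a • p.1 + b • p.2) := by fun_prop
    exact hc.stronglyMeasurable.integral_prod_right'
  have h2 : MemLp (fun x => |a| * N x) 2 (_root_.stdGaussian n) :=
    (hN.memLp (by norm_num)).const_mul _
  exact ((memLp_const (c + |b| * ∫ z, N z ∂(_root_.stdGaussian n))).add h2).mono'
    hm.aestronglyMeasurable (Filter.Eventually.of_forall fun x => hN.abs_noise_le hf hb a b x)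

lemma single_le (hN : IsUncondSeminorm N) (i : Fin n) :
    N (Pi.single i 1) ≤ gaussianAbsMoment⁻¹ * ∫ x, N x ∂(_root_.stdGaussian n) := by
  obtain ⟨y, hy, hyi⟩ := hN.exists_supporting (Pi.single i 1)
  have h1 := hN.sum_abs_mul_gaussianAbsMoment_le hy
  have h2 : N (Pi.single i 1) = y i := by
    rw [← hyi, Finset.sum_eq_single i] <;> simp +contextual
  have h3 : |y i| ≤ ∑ j, |y j| :=
    Finset.single_le_sum (f := fun j => |y j|) (fun j _ => abs_nonneg _) (Finset.mem_univ i)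
  rw [h2, inv_mul_eq_div, le_div_iff₀ gaussianAbsMoment_pos]
  refine le_trans ?_ h1
  have := gaussianAbsMoment_pos
  gcongr
  exact (le_abs_self _).trans h3

lemma sub_piecewise_singleton_le (hN : IsUncondSeminorm N) (i : Fin n) (x : Fin n → ℝ) :
    N x - N (({i} : Finset (Fin n)).piecewise 0 x)
      ≤ gaussianAbsMoment⁻¹ * (∫ x, N x ∂(_root_.stdGaussian n)) * |x i| := by
  refine (hN.sub_le _ _).trans ?_
  have e : x - ({i} : Finset (Fin n)).piecewise 0 x = x i • Pi.single i 1 := by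
    ext j
    by_cases hj : j = i
    · subst hj
      simp
    · simp [hj]
  rw [e, hN.smul, mul_comm]
  gcongr
  exact hN.single_le i

end IsUncondSeminorm

/-- The sixth absolute moment of a standard Gaussian variable. -/
noncomputable def gaussianSixthMoment : ℝ := ∫ x, |x| ^ 6 ∂gaussianReal 0 1

lemma gaussianSixthMoment_nonneg : 0 ≤ gaussianSixthMoment :=
  integral_nonneg fun x => by positivity

lemma integrable_abs_pow_six_gaussianReal :
    Integrable (fun x : ℝ => |x| ^ 6) (gaussianReal 0 1) :=
  (memLp_id_gaussianReal 6).integrable_norm_pow (by norm_num)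

lemma integrable_abs_pow_six_eval_stdGaussian (i : Fin n) :
    Integrable (fun x => |x i| ^ 6) (_root_.stdGaussian n) :=
  (measurePreserving_eval_stdGaussian i).integrable_comp_of_integrable
    integrable_abs_pow_six_gaussianReal

lemma integral_abs_pow_six_eval_stdGaussian (i : Fin n) :
    ∫ x, |x i| ^ 6 ∂(_root_.stdGaussian n) = gaussianSixthMoment :=
  (measurePreserving_eval_stdGaussian i).integral_comp_of_aestronglyMeasurable
    (g := fun x => |x| ^ 6) integrable_abs_pow_six_gaussianReal.aestronglyMeasurable

namespace IsUncondSeminorm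

lemma integral_influence_sq_le (hN : IsUncondSeminorm N) (hM : MinimalMPosition n N) (hn : 1 ≤ n)
    (hN1 : ∫ x, N x ∂(_root_.stdGaussian n) = 1) (i : Fin n) :
    ∫ x, (N x - N (({i} : Finset (Fin n)).piecewise 0 x)) ^ 2 ∂(_root_.stdGaussian n)
      ≤ (2 + gaussianAbsMoment⁻¹ ^ 6 * gaussianSixthMoment) * (n : ℝ) ^ (-(3 / 4) : ℝ) := by
  have hn1 : (1 : ℝ) ≤ n := by exact_mod_cast hn
  have hn0 : (0 : ℝ) < n := by linarith
  set D : (Fin n → ℝ) → ℝ := fun x => N x - N (({i} : Finset (Fin n)).piecewise 0 x) with hD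
  have hi := hN.comp_piecewise_zero {i}
  have hD0 (x) : 0 ≤ D x := sub_nonneg.2 (hN.piecewise_zero_le {i} x)
  have iD : Integrable D (_root_.stdGaussian n) := hN.integrable.sub hi.integrable
  have hD1 : ∫ x, D x ∂(_root_.stdGaussian n) ≤ 2 / n := by
    have := hN.integral_sub_piecewise_le hM hn {i}
    rw [hN1] at this
    simpa using this
  have a0 := gaussianAbsMoment_pos
  have m0 := gaussianSixthMoment_nonneg
  set k : ℝ := (n : ℝ) ^ (1 / 4 : ℝ) with hk
  have hk0 : 0 < k := by positivity
  have hkn : k ^ 4 = n := by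
    rw [hk, ← Real.rpow_natCast, ← Real.rpow_mul hn0.le]
    norm_num
  have hk1 : k / n = (n : ℝ) ^ (-(3 / 4) : ℝ) := by
    rw [hk, ← Real.rpow_sub_one hn0.ne']
    norm_num
  have hle (x : Fin n → ℝ) : D x ^ 2 ≤ k * D x + (gaussianAbsMoment⁻¹ ^ 6 / n) * |x i| ^ 6 := by
    have hx := hN.sub_piecewise_singleton_le i x
    rw [hN1, mul_one] at hx
    have h0 : 0 ≤ (gaussianAbsMoment⁻¹ ^ 6 / n) * |x i| ^ 6 := by positivity
    rcases le_or_gt (D x) k with h | h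
    · nlinarith [hD0 x]
    · have h1 : D x ^ 6 ≤ gaussianAbsMoment⁻¹ ^ 6 * |x i| ^ 6 := by
        rw [← mul_pow]
        exact pow_le_pow_left₀ (hD0 x) hx 6
      have h2 : D x ^ 2 * n ≤ D x ^ 6 := by
        rw [← hkn]
        calc D x ^ 2 * k ^ 4 ≤ D x ^ 2 * D x ^ 4 := by gcongr
          _ = D x ^ 6 := by ring
      have h3 : D x ^ 2 ≤ (gaussianAbsMoment⁻¹ ^ 6 / n) * |x i| ^ 6 := by
        rw [div_mul_eq_mul_div, le_div_iff₀ hn0]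
        exact h2.trans h1
      nlinarith [hD0 x]
  have iR : Integrable (fun x : Fin n → ℝ => k * D x + (gaussianAbsMoment⁻¹ ^ 6 / n) * |x i| ^ 6)
      (_root_.stdGaussian n) :=
    (iD.const_mul _).add ((integrable_abs_pow_six_eval_stdGaussian i).const_mul _)
  have h4 := integral_mono_of_nonneg (μ := _root_.stdGaussian n)
    (Filter.Eventually.of_forall fun x => sq_nonneg (D x)) iR (Filter.Eventually.of_forall hle)
  rw [integral_add (iD.const_mul _) ((integrable_abs_pow_six_eval_stdGaussian i).const_mul _),
    integral_const_mul, integral_const_mul, integral_abs_pow_six_eval_stdGaussian] at h4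
  refine h4.trans ?_
  rw [← hk1]
  have hk2 : 1 ≤ k := Real.one_le_rpow hn1 (by norm_num)
  have h5 : k * ∫ x, D x ∂(_root_.stdGaussian n) ≤ k * (2 / n) := by gcongr
  have h6 : gaussianAbsMoment⁻¹ ^ 6 / n * gaussianSixthMoment
      ≤ gaussianAbsMoment⁻¹ ^ 6 / n * gaussianSixthMoment * k :=
    le_mul_of_one_le_right (by positivity) hk2
  have e : (2 + gaussianAbsMoment⁻¹ ^ 6 * gaussianSixthMoment) * (k / n)
      = k * (2 / n) + gaussianAbsMoment⁻¹ ^ 6 / n * gaussianSixthMoment * k := by ring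
  rw [e]
  linarith

end IsUncondSeminorm

end Influences

section NoiseStability

variable {n : ℕ} {N : (Fin n → ℝ) → ℝ}

/-- The constant in the noise stability bound for functions of `N`. -/
noncomputable def noiseConst : ℝ :=
  2 * ((2 : ℝ) ^ (1 / 2 : ℝ) *
    (2 + gaussianAbsMoment⁻¹ ^ 6 * gaussianSixthMoment) ^ (3 / 4 : ℝ))

lemma noiseConst_pos : 0 < noiseConst := by
  have := gaussianSixthMoment_nonneg
  have := gaussianAbsMoment_pos
  unfold noiseConst
  positivity

namespace IsUncondSeminorm

lemma integral_noise_influence_sq_le (hN : IsUncondSeminorm N) (hM : MinimalMPosition n N)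
    (hn : 1 ≤ n) (hN1 : ∫ x, N x ∂(_root_.stdGaussian n) = 1) (i : Fin n) :
    ∫ x, (∫ z, (N ((√2)⁻¹ • x + (√2)⁻¹ • z)
        - N (({i} : Finset (Fin n)).piecewise 0 ((√2)⁻¹ • x + (√2)⁻¹ • z)))
        ∂(_root_.stdGaussian n)) ^ 2 ∂(_root_.stdGaussian n)
      ≤ noiseConst / 2 * (n : ℝ) ^ (-(17 / 16) : ℝ) := by
  have hn1 : (1 : ℝ) ≤ n := by exact_mod_cast hn
  have hn0 : (0 : ℝ) < n := by linarith
  set D : (Fin n → ℝ) → ℝ := fun x => N x - N (({i} : Finset (Fin n)).piecewise 0 x) with hD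
  have hi := hN.comp_piecewise_zero {i}
  have hD0 (x) : 0 ≤ D x := sub_nonneg.2 (hN.piecewise_zero_le {i} x)
  have hDc : Continuous D := hN.continuous.sub hi.continuous
  have hDb (v) : |D v| ≤ 0 + N v := by
    rw [abs_of_nonneg (hD0 v)]
    linarith [hi.nonneg v]
  have h := integral_noise_sq_le (μ := _root_.stdGaussian n) integral_id_stdGaussian
    hDc.measurable hD0 ((hN.memLp (by norm_num)).sub (hi.memLp (by norm_num)))
    (fun x => hN.integrable_slice hDc hDb _ _ x)
  refine h.trans ?_
  have hD1 : ∫ x, D x ∂(_root_.stdGaussian n) ≤ 2 / n := by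
    have := hN.integral_sub_piecewise_le hM hn {i}
    rw [hN1] at this
    simpa using this
  have hD2 := hN.integral_influence_sq_le hM hn hN1 i
  have m0 := gaussianSixthMoment_nonneg
  have a0 := gaussianAbsMoment_pos
  have i0 : 0 ≤ ∫ x, D x ∂(_root_.stdGaussian n) := integral_nonneg hD0
  have i1 : 0 ≤ ∫ x, D x ^ 2 ∂(_root_.stdGaussian n) := integral_nonneg fun x => sq_nonneg _
  set c := 2 + gaussianAbsMoment⁻¹ ^ 6 * gaussianSixthMoment with hc
  have hc0 : 0 < c := by positivity
  calc _ ≤ (2 / n : ℝ) ^ (1 / 2 : ℝ) * (c * (n : ℝ) ^ (-(3 / 4) : ℝ)) ^ (3 / 4 : ℝ) := by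
        gcongr
    _ = noiseConst / 2 * (n : ℝ) ^ (-(17 / 16) : ℝ) := by
        rw [div_eq_mul_inv, Real.mul_rpow (by norm_num) (by positivity),
          Real.mul_rpow hc0.le (by positivity), ← Real.rpow_mul hn0.le, ← Real.rpow_neg_one,
          ← Real.rpow_mul hn0.le, noiseConst, ← hc]
        have e : (n : ℝ) ^ (-(17 / 16) : ℝ)
            = (n : ℝ) ^ (-1 * (1 / 2) : ℝ) * (n : ℝ) ^ (-(3 / 4) * (3 / 4) : ℝ) := by
          rw [← Real.rpow_add hn0]
          norm_num
        rw [e]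
        ring

lemma noiseCorr_le (hN : IsUncondSeminorm N) (hM : MinimalMPosition n N)
    (hn : 1 ≤ n) (hN1 : ∫ x, N x ∂(_root_.stdGaussian n) = 1) {g : (Fin n → ℝ) → ℝ}
    (hg : Continuous g) {c : ℝ} (hgb : ∀ v, |g v| ≤ c + N v)
    (hgN : ∀ v w, |g v - g w| ≤ |N v - N w|) (hg0 : ∫ x, g x ∂(_root_.stdGaussian n) = 0) :
    noiseCorr (_root_.stdGaussian n) g (1 / 2) √(3 / 4)
      ≤ noiseConst * (n : ℝ) ^ (-(1 / 16) : ℝ) := by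
  set γ := _root_.stdGaussian n with hγ
  set s : ℝ := (√2)⁻¹ with hs
  set h : (Fin n → ℝ) → ℝ := fun x => ∫ z, g (s • x + s • z) ∂γ with hh
  have hgm : MemLp g 2 γ :=
    ((memLp_const c).add (hN.memLp (by norm_num))).mono' hg.aestronglyMeasurable
      (Filter.Eventually.of_forall hgb)
  have hs2 : s ^ 2 = 1 / 2 := by
    rw [hs, inv_pow, Real.sq_sqrt (by norm_num)]
    norm_num
  have hsq : ∫ x, h x ^ 2 ∂γ = noiseCorr γ g (1 / 2) √(3 / 4) := by
    rw [← hs2]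
    refine integral_noise_sq_eq integral_id_stdGaussian sq_sqrt_two_inv ?_ (by positivity) hgm
    rw [hs2, Real.sq_sqrt (by norm_num)]
    norm_num
  have hhm : MemLp h 2 γ := hN.memLp_noise hg hgb s s
  have hlin := measurePreserving_linearComb (μ := γ) integral_id_stdGaussian sq_sqrt_two_inv
  have hh0 : ∫ x, h x ∂γ = 0 := by
    have hgi : Integrable g γ := hgm.integrable (by norm_num)
    rw [hh, integral_integral (f := fun x z => g (s • x + s • z))
      (hlin.integrable_comp_of_integrable hgi)]
    rw [hlin.integral_comp_of_aestronglyMeasurable hg.aestronglyMeasurable, hg0]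
  have hes := efron_stein (ι := Fin n) (ν := gaussianReal 0 1) (h := h) hhm
  change ∫ x, h x ^ 2 ∂γ - (∫ x, h x ∂γ) ^ 2 ≤ (1 / 2) * ∑ i, ∫ p : (Fin n → ℝ) × (Fin n → ℝ),
    (h p.1 - h (({i} : Finset (Fin n)).piecewise p.2 p.1)) ^ 2 ∂(γ.prod γ) at hes
  rw [hh0, hsq] at hes
  have hinf : ∀ i : Fin n, ∫ p : (Fin n → ℝ) × (Fin n → ℝ),
      (h p.1 - h (({i} : Finset (Fin n)).piecewise p.2 p.1)) ^ 2 ∂(γ.prod γ)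
        ≤ 2 * noiseConst * (n : ℝ) ^ (-(17 / 16) : ℝ) := fun i => by
    have hi := hN.comp_piecewise_zero {i}
    set D : (Fin n → ℝ) → ℝ := fun x => N x - N (({i} : Finset (Fin n)).piecewise 0 x) with hD
    have hD0 (x) : 0 ≤ D x := sub_nonneg.2 (hN.piecewise_zero_le {i} x)
    have hDc : Continuous D := hN.continuous.sub hi.continuous
    have hDb (v) : |D v| ≤ 0 + N v := by
      rw [abs_of_nonneg (hD0 v)]
      linarith [hi.nonneg v]
    set U : (Fin n → ℝ) → ℝ := fun x => ∫ z, D (s • x + s • z) ∂γ with hU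
    have hUm : MemLp U 2 γ := hN.memLp_noise hDc hDb s s
    have hU2 : ∫ x, U x ^ 2 ∂γ ≤ noiseConst / 2 * (n : ℝ) ^ (-(17 / 16) : ℝ) :=
      hN.integral_noise_influence_sq_le hM hn hN1 i
    set g' : (Fin n → ℝ) → ℝ := fun x => g (({i} : Finset (Fin n)).piecewise 0 x) with hg'
    have hg'c : Continuous g' := hg.comp (continuous_piecewise_zero {i})
    have hg'b (v) : |g' v| ≤ c + N v := (hgb _).trans (by linarith [hN.piecewise_zero_le {i} v])
    set e : (Fin n → ℝ) → ℝ := fun x => ∫ z, g' (s • x + s • z) ∂γ with he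
    have hhe (x) : |h x - e x| ≤ U x := by
      rw [hh, he]
      simp only
      rw [← integral_sub (hN.integrable_slice hg hgb s s x) (hN.integrable_slice hg'c hg'b s s x)]
      refine abs_integral_le_integral_abs.trans (integral_mono
        ((hN.integrable_slice hg hgb s s x).sub (hN.integrable_slice hg'c hg'b s s x)).abs
        (hN.integrable_slice hDc hDb s s x) fun z => ?_)
      refine (hgN _ _).trans (le_of_eq ?_)
      exact abs_of_nonneg (hD0 _)
    have hee (p : (Fin n → ℝ) × (Fin n → ℝ)) :
        e (({i} : Finset (Fin n)).piecewise p.2 p.1) = e p.1 := by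
      rw [he]
      simp only [hg']
      congr 1
      ext z
      congr 1
      ext j
      by_cases hj : j = i
      · subst hj
        simp
      · simp [hj]
    have hpw : MeasurePreserving (fun p : (Fin n → ℝ) × (Fin n → ℝ) =>
        ({i} : Finset (Fin n)).piecewise p.2 p.1) (γ.prod γ) γ := measurePreserving_piecewise _
    have j1 : Integrable (fun p : (Fin n → ℝ) × (Fin n → ℝ) => U p.1 ^ 2) (γ.prod γ) :=
      measurePreserving_fst.integrable_comp_of_integrable hUm.integrable_sq
    have j2 : Integrable (fun p : (Fin n → ℝ) × (Fin n → ℝ) =>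
        U (({i} : Finset (Fin n)).piecewise p.2 p.1) ^ 2) (γ.prod γ) :=
      hpw.integrable_comp_of_integrable hUm.integrable_sq
    have k1 : ∫ p : (Fin n → ℝ) × (Fin n → ℝ), U p.1 ^ 2 ∂(γ.prod γ) = ∫ x, U x ^ 2 ∂γ :=
      measurePreserving_fst.integral_comp_of_aestronglyMeasurable (g := fun x => U x ^ 2)
        hUm.integrable_sq.aestronglyMeasurable
    have k2 : ∫ p : (Fin n → ℝ) × (Fin n → ℝ),
        U (({i} : Finset (Fin n)).piecewise p.2 p.1) ^ 2 ∂(γ.prod γ) = ∫ x, U x ^ 2 ∂γ :=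
      hpw.integral_comp_of_aestronglyMeasurable (g := fun x => U x ^ 2)
        hUm.integrable_sq.aestronglyMeasurable
    have hle : ∫ p : (Fin n → ℝ) × (Fin n → ℝ),
        (h p.1 - h (({i} : Finset (Fin n)).piecewise p.2 p.1)) ^ 2 ∂(γ.prod γ)
        ≤ ∫ p : (Fin n → ℝ) × (Fin n → ℝ), (2 * U p.1 ^ 2
          + 2 * U (({i} : Finset (Fin n)).piecewise p.2 p.1) ^ 2) ∂(γ.prod γ) := by
      refine integral_mono_of_nonneg (Filter.Eventually.of_forall fun p => sq_nonneg _)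
        ((j1.const_mul 2).add (j2.const_mul 2)) (Filter.Eventually.of_forall fun p => ?_)
      have h1 := hhe p.1
      have h2 := hhe (({i} : Finset (Fin n)).piecewise p.2 p.1)
      rw [hee] at h2
      have h3 := sq_le_sq' (neg_le_of_abs_le h1) (le_of_abs_le h1)
      have h4 := sq_le_sq' (neg_le_of_abs_le h2) (le_of_abs_le h2)
      change (h p.1 - h (({i} : Finset (Fin n)).piecewise p.2 p.1)) ^ 2 ≤ _
      nlinarith [sq_nonneg ((h p.1 - e p.1) + (h (({i} : Finset (Fin n)).piecewise p.2 p.1) - e p.1))]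
    rw [integral_add (j1.const_mul 2) (j2.const_mul 2), integral_const_mul, integral_const_mul,
      k1, k2] at hle
    linarith
  have hsum := Finset.sum_le_sum fun i (_ : i ∈ Finset.univ) => hinf i
  rw [Finset.sum_const, Finset.card_univ, Fintype.card_fin, nsmul_eq_mul] at hsum
  have hn0 : (0 : ℝ) < n := by exact_mod_cast hn
  have e : (n : ℝ) * (n : ℝ) ^ (-(17 / 16) : ℝ) = (n : ℝ) ^ (-(1 / 16) : ℝ) := by
    rw [mul_comm, ← Real.rpow_add_one hn0.ne']
    norm_num
  rw [← e]
  linarith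

end IsUncondSeminorm

end NoiseStability

section Superconcentration

/-- Superconcentration: the variance of a localized Lipschitz function of the norm. -/
lemma exists_integral_sub_sq_le : ∃ C > (0 : ℝ), ∃ L₀ ≥ (1 : ℝ), ∀ n : ℕ, 1 ≤ n →
    L₀ ≤ Real.log n → ∀ N : (Fin n → ℝ) → ℝ,
    IsUncondSeminorm N → MinimalMPosition n N → ∫ x, N x ∂(_root_.stdGaussian n) = 1 →
    ∀ φ : ℝ → ℝ, LipschitzWith 1 φ → ∀ J : Set ℝ, MeasurableSet J → ∀ η > (0 : ℝ),
    (∀ a b, a < b → φ a ≠ φ b → b ∈ J ∨ η < b - a) →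
    ∫ x, (φ (N x) - ∫ z, φ (N z) ∂(_root_.stdGaussian n)) ^ 2 ∂(_root_.stdGaussian n)
      ≤ C * ((_root_.stdGaussian n).real {x | N x ∈ J} / Real.log n ^ 2
          + (n : ℝ) ^ (-(1 / 32) : ℝ)) := by
  obtain ⟨B, hB0, hB⟩ := exists_sum_sq_mul_log_le
  have hC2 := noiseConst_pos
  refine ⟨256 * B + √noiseConst, by positivity, 1 + 32 * |Real.log noiseConst|,
    le_add_of_nonneg_right (by positivity), fun n hn hL N hN hM hN1 φ hφ J hJ η hη hφJ => ?_⟩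
  set γ := _root_.stdGaussian n with hγ
  set m := ∫ z, φ (N z) ∂γ with hm
  set g : (Fin n → ℝ) → ℝ := fun x => φ (N x) - m with hg
  set p := γ.real {x | N x ∈ J} with hp
  set L := Real.log n with hLdef
  have hn0 : (0 : ℝ) < n := by exact_mod_cast hn
  have hp0 : 0 ≤ p := measureReal_nonneg
  have hL0 : 0 < L := lt_of_lt_of_le (by positivity) hL
  have hφ' (a b : ℝ) : |φ a - φ b| ≤ |a - b| := by
    have := hφ.dist_le_mul a b
    simpa [Real.dist_eq] using this
  have hφc : Continuous fun x => φ (N x) := hφ.continuous.comp hN.continuous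
  have hgc : Continuous g := hφc.sub continuous_const
  have hφb (v) : |φ (N v)| ≤ |φ 0| + N v := by
    have h1 := hφ' (N v) 0
    rw [sub_zero, abs_of_nonneg (hN.nonneg v)] at h1
    have := abs_sub_abs_le_abs_sub (φ (N v)) (φ 0)
    linarith
  have hgb (v) : |g v| ≤ (|φ 0| + |m|) + N v := by
    have := abs_sub (φ (N v)) m
    have := hφb v
    change |φ (N v) - m| ≤ _
    linarith
  have hgN (v w) : |g v - g w| ≤ |N v - N w| := by
    have e : g v - g w = φ (N v) - φ (N w) := by
      simp only [hg]
      ring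
    rw [e]
    exact hφ' _ _
  have hgm : MemLp g 2 γ :=
    ((memLp_const (|φ 0| + |m|)).add (hN.memLp (by norm_num))).mono' hgc.aestronglyMeasurable
      (Filter.Eventually.of_forall hgb)
  have hφi : Integrable (fun x => φ (N x)) γ :=
    ((integrable_const |φ 0|).add hN.integrable).mono' hφc.aestronglyMeasurable
      (Filter.Eventually.of_forall hφb)
  have hg0 : ∫ x, g x ∂γ = 0 := by
    rw [hg, integral_sub hφi (integrable_const _), integral_const, probReal_univ, one_smul, ← hm,
      sub_self]
  have hnc := hN.noiseCorr_le hM hn hN1 hgc hgb hgN hg0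
  change ∫ x, g x ^ 2 ∂γ ≤ _
  set V := ∫ x, g x ^ 2 ∂γ with hV
  have hsε : √noiseConst * (n : ℝ) ^ (-(1 / 32) : ℝ) > 0 := by positivity
  rcases le_or_gt V (√noiseConst * (n : ℝ) ^ (-(1 / 32) : ℝ)) with h | h
  · refine h.trans ?_
    have : 0 ≤ 256 * B * (p / L ^ 2 + (n : ℝ) ^ (-(1 / 32) : ℝ)) := by positivity
    have : 0 ≤ √noiseConst * (p / L ^ 2) := by positivity
    linarith
  · have hV0 : 0 < V := hsε.trans h
    obtain ⟨K, hK0, hK⟩ := integral_small_noise_sq_le (μ := γ) integral_id_stdGaussian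
      hN.add_le hN.smul hN.continuous (hN.memLp (by norm_num)) (B2 := B / L) (fun v => by
        obtain ⟨y, hy1, hy2⟩ := hN.exists_supporting v
        refine ⟨coordForm y, fun x => ?_, ?_, ?_⟩
        · rw [coordForm_apply]
          exact hy1 x
        · rw [coordForm_apply, hy2]
        · simp_rw [coordForm_apply]
          rw [integral_linear_sq_stdGaussian, le_div_iff₀ hL0]
          exact hB n hn N hN hM hN1 y hy1) hφ hJ hη hφJ
    have hlow := noiseCorr_half_ge (μ := γ) integral_id_stdGaussian hgm hV0
      (D := B / L * p) (K := K) (by positivity) hK0 (fun a b ha hb hab => by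
        have := hK a b ha hb hab
        refine le_trans (le_of_eq ?_) this
        congr 1
        ext q
        simp only [hg]
        ring)
    rw [← hV] at hlow
    have h1 : √noiseConst * (n : ℝ) ^ (-(1 / 32) : ℝ) * Real.exp (-(4 * (B / L * p) / V))
        ≤ noiseConst * (n : ℝ) ^ (-(1 / 16) : ℝ) :=
      (mul_le_mul_of_nonneg_right h.le (Real.exp_pos _).le).trans (hlow.trans hnc)
    have e : noiseConst * (n : ℝ) ^ (-(1 / 16) : ℝ) = √noiseConst * (n : ℝ) ^ (-(1 / 32) : ℝ)
        * (√noiseConst * (n : ℝ) ^ (-(1 / 32) : ℝ)) := by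
      have e1 : (n : ℝ) ^ (-(1 / 16) : ℝ)
          = (n : ℝ) ^ (-(1 / 32) : ℝ) * (n : ℝ) ^ (-(1 / 32) : ℝ) := by
        rw [← Real.rpow_add hn0]
        norm_num
      rw [e1]
      nth_rewrite 1 [← Real.mul_self_sqrt hC2.le]
      ring
    rw [e] at h1
    have h2 := Real.log_le_log (Real.exp_pos _) (le_of_mul_le_mul_left h1 hsε)
    rw [Real.log_exp, Real.log_mul (by positivity) (by positivity), Real.log_sqrt hC2.le,
      Real.log_rpow hn0, ← hLdef] at h2
    have h3 := le_abs_self (Real.log noiseConst)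
    have h4 : L / 64 ≤ 4 * (B / L * p) / V := by linarith
    rw [le_div_iff₀ hV0] at h4
    have h5 : V ≤ 256 * B * (p / L ^ 2) := by
      have e2 : 256 * B * (p / L ^ 2) = (4 * (B / L * p)) * (64 / L) := by
        field_simp
        ring
      rw [e2]
      calc V = L / 64 * V * (64 / L) := by field_simp
        _ ≤ _ := by gcongr
    have h6 : 0 ≤ 256 * B * (n : ℝ) ^ (-(1 / 32) : ℝ) := by positivity
    have h7 : 0 ≤ √noiseConst * (p / L ^ 2 + (n : ℝ) ^ (-(1 / 32) : ℝ)) := by positivity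
    linarith

end Superconcentration

section Deviation

/-- The ramp `r ↦ min h (|r - 1| - s)₊`. -/
noncomputable def ramp (s h r : ℝ) : ℝ := max 0 (min h (|r - 1| - s))

lemma lipschitzWith_ramp (s h : ℝ) : LipschitzWith 1 (ramp s h) := by
  refine LipschitzWith.of_dist_le_mul fun a b => ?_
  rw [Real.dist_eq, Real.dist_eq, NNReal.coe_one, one_mul]
  have h1 : |(|a - 1| - s) - (|b - 1| - s)| ≤ |a - b| := by
    have := abs_abs_sub_abs_le (a - 1) (b - 1)
    rw [show a - 1 - (b - 1) = a - b by ring] at this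
    rwa [show (|a - 1| - s) - (|b - 1| - s) = |a - 1| - |b - 1| by ring]
  have h2 := abs_min_sub_min_le_max h (|a - 1| - s) h (|b - 1| - s)
  rw [sub_self, abs_zero, max_eq_right (abs_nonneg _)] at h2
  have h3 := abs_max_sub_max_le_max 0 (min h (|a - 1| - s)) 0 (min h (|b - 1| - s))
  rw [sub_self, abs_zero, max_eq_right (abs_nonneg (min h _ - min h _))] at h3
  exact h3.trans (h2.trans h1)

lemma ramp_eq_zero {s h r : ℝ} (hr : |r - 1| ≤ s) : ramp s h r = 0 :=
  max_eq_left ((min_le_right _ _).trans (by linarith))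

lemma ramp_eq {s h r : ℝ} (hh : 0 ≤ h) (hr : s + h ≤ |r - 1|) : ramp s h r = h := by
  rw [ramp, min_eq_left (by linarith), max_eq_right hh]

lemma mem_or_lt_of_ramp_ne {s h a b : ℝ} (hab : a < b) (hne : ramp s h a ≠ ramp s h b) :
    b ∈ {r | s - h < |r - 1|} ∨ h < b - a := by
  by_contra hcon
  rw [not_or, not_lt, Set.mem_ofPred_eq, not_lt] at hcon
  obtain ⟨h1, h2⟩ := hcon
  have h3 : |a - 1| ≤ s := by
    have := abs_sub_le a b 1
    rw [abs_of_neg (by linarith : a - b < 0)] at this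
    linarith
  have h4 : |b - 1| ≤ s := by linarith
  exact hne (by rw [ramp_eq_zero h3, ramp_eq_zero h4])

/-- A function equal to `h` and to `0` on two disjoint events has large variance. -/
lemma sq_mul_measure_mul_measure_le {Ω : Type*} [MeasurableSpace Ω] {μ : Measure Ω}
    [IsProbabilityMeasure μ] {f : Ω → ℝ} {h m : ℝ} {A B : Set Ω} (hA : MeasurableSet A)
    (hB : MeasurableSet B) (hAB : Disjoint A B) (hfA : ∀ x ∈ A, f x = h) (hfB : ∀ x ∈ B, f x = 0)
    (hf : Integrable (fun x => (f x - m) ^ 2) μ) :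
    h ^ 2 * (μ.real A * μ.real B) ≤ ∫ x, (f x - m) ^ 2 ∂μ := by
  have h1 : ∫ x, (A.indicator (fun _ => (h - m) ^ 2) x + B.indicator (fun _ => m ^ 2) x) ∂μ
      ≤ ∫ x, (f x - m) ^ 2 ∂μ := by
    refine integral_mono (((integrable_const _).indicator hA).add
      ((integrable_const _).indicator hB)) hf fun x => ?_
    by_cases hxA : x ∈ A
    · have hxB : x ∉ B := Set.disjoint_left.1 hAB hxA
      simp [hxA, hxB, hfA x hxA]
    · by_cases hxB : x ∈ B
      · simp [hxA, hxB, hfB x hxB]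
      · simp [hxA, hxB, sq_nonneg]
  rw [integral_add ((integrable_const _).indicator hA) ((integrable_const _).indicator hB),
    integral_indicator_const _ hA, integral_indicator_const _ hB, smul_eq_mul, smul_eq_mul] at h1
  have h2 : μ.real A + μ.real B ≤ 1 := by
    rw [← measureReal_union hAB hB]
    exact measureReal_le_one
  have hA0 : 0 ≤ μ.real A := measureReal_nonneg
  have hB0 : 0 ≤ μ.real B := measureReal_nonneg
  refine le_trans ?_ h1
  set q := μ.real A
  set r := μ.real B
  have h3 : (q + r) * (q * (h - m) ^ 2 + r * m ^ 2) ≤ q * (h - m) ^ 2 + r * m ^ 2 :=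
    mul_le_of_le_one_left (by positivity) h2
  nlinarith [sq_nonneg (q * (h - m) - r * m)]

lemma sq_mul_exp_neg_le {x : ℝ} (hx : 0 ≤ x) : x ^ 2 * Real.exp (-x) ≤ 2 := by
  have h1 := Real.quadratic_le_exp_of_nonneg hx
  have h2 : x ^ 2 ≤ 2 * Real.exp x := by linarith
  calc x ^ 2 * Real.exp (-x) ≤ 2 * Real.exp x * Real.exp (-x) := by gcongr
    _ = 2 := by rw [mul_assoc, ← Real.exp_add, add_neg_cancel, Real.exp_zero, mul_one]

/-- Exponential deviation inequality at bounded distance from the mean. -/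
lemma exists_measure_lt_abs_sub_one_le : ∃ C > (0 : ℝ), ∃ c > (0 : ℝ), ∃ L₀ ≥ (1 : ℝ), ∀ n : ℕ,
    1 ≤ n → L₀ ≤ Real.log n → ∀ N : (Fin n → ℝ) → ℝ,
    IsUncondSeminorm N → MinimalMPosition n N → ∫ x, N x ∂(_root_.stdGaussian n) = 1 →
    ∀ t : ℝ, 0 ≤ t → t ≤ 36 → (_root_.stdGaussian n).real {x | t < |N x - 1|}
      ≤ C * Real.exp (-(c * t * Real.log n)) := by
  obtain ⟨C, hC0, L₀, hL₀, hC⟩ := exists_integral_sub_sq_le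
  set A := √(8 * C) with hA
  have hA0 : 0 < A := by positivity
  have hAsq : A ^ 2 = 8 * C := Real.sq_sqrt (by positivity)
  refine ⟨3 + 8192, by norm_num, min (1 / (2 * A)) (1 / 2304), by positivity, max L₀ 640,
    le_max_of_le_left hL₀, fun n hn hL N hN hM hN1 t ht ht36 => ?_⟩
  set γ := _root_.stdGaussian n with hγ
  set L := Real.log n with hLdef
  have hL1 : L₀ ≤ L := (le_max_left _ _).trans hL
  have hL2 : 640 ≤ L := (le_max_right _ _).trans hL
  have hL0 : 0 < L := by linarith
  have hn0 : (0 : ℝ) < n := by exact_mod_cast hn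
  set ν := (n : ℝ) ^ (-(1 / 32) : ℝ) with hν
  have hν0 : 0 < ν := by positivity
  set ε := L ^ 2 * ν with hε
  have hε0 : 0 ≤ ε := by positivity
  have hεle : ε ≤ 8192 * Real.exp (-(L / 64)) := by
    have h1 : ν = Real.exp (-(L / 64)) * Real.exp (-(L / 64)) := by
      rw [hν, Real.rpow_def_of_pos hn0, ← Real.exp_add, ← hLdef]
      congr 1
      ring
    have h2 := sq_mul_exp_neg_le (x := L / 64) (by positivity)
    rw [hε, h1]
    have := Real.exp_pos (-(L / 64))
    calc L ^ 2 * (Real.exp (-(L / 64)) * Real.exp (-(L / 64)))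
        = 4096 * ((L / 64) ^ 2 * Real.exp (-(L / 64))) * Real.exp (-(L / 64)) := by ring
      _ ≤ 4096 * 2 * Real.exp (-(L / 64)) := by gcongr
      _ = _ := by norm_num
  have hε1 : ε ≤ 1 := by
    have h1 : Real.exp (-(L / 64)) ≤ Real.exp (-10) := Real.exp_le_exp.2 (by linarith)
    have h2 : Real.exp (-10) ≤ 1 / 8192 := by
      rw [Real.exp_neg, ← one_div]
      refine one_div_le_one_div_of_le (by norm_num) ?_
      have : Real.exp 10 = Real.exp 1 ^ 10 := by rw [← Real.exp_nat_mul]; norm_num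
      rw [this]
      calc (8192 : ℝ) ≤ 2.7 ^ 10 := by norm_num
        _ ≤ _ := pow_le_pow_left₀ (by norm_num) (Real.exp_one_gt_d9.le.trans' (by norm_num)) 10
    linarith
  set h := A / L with hh
  have hh0 : 0 < h := by positivity
  have hhsq : h ^ 2 = 8 * C / L ^ 2 := by rw [hh, div_pow, hAsq]
  set P : ℝ → ℝ := fun s => γ.real {x | s < |N x - 1|} with hP
  have hPm (s : ℝ) : MeasurableSet {x | s < |N x - 1|} :=
    measurableSet_lt measurable_const (hN.continuous.measurable.sub_const 1).abs
  have hP1 (s) : P s ≤ 1 := measureReal_le_one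
  have hP0 (s) : 0 ≤ P s := measureReal_nonneg
  have hanti {s s' : ℝ} (hs : s ≤ s') : P s' ≤ P s :=
    measureReal_mono fun x (hx : s' < |N x - 1|) => hs.trans_lt hx
  have hCν : C * (1 / L ^ 2 + ν) = h ^ 2 * ((1 + ε) / 8) := by
    rw [hhsq, hε]
    field_simp
  have hPh : P h ≤ 1 / 2 := by
    have h1 := hC n hn hL1 N hN hM hN1 id LipschitzWith.id Set.univ MeasurableSet.univ 1 one_pos
      fun a b _ _ => Or.inl (Set.mem_univ b)
    have hN1' : ∫ x, N x ∂(_root_.stdGaussian n) = 1 := hN1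
    simp only [id, hN1', Set.mem_univ, Set.ofPred_true, probReal_univ] at h1
    rw [← hLdef, ← hν, hCν] at h1
    have i1 : Integrable (fun x => (N x - 1) ^ 2) γ :=
      ((hN.memLp (by norm_num)).sub (memLp_const 1)).integrable_sq
    have h2 := mul_meas_ge_le_integral_of_nonneg (μ := γ)
      (Filter.Eventually.of_forall fun x => sq_nonneg (N x - 1)) i1 (h ^ 2)
    have h3 : P h ≤ γ.real {x | h ^ 2 ≤ (N x - 1) ^ 2} := measureReal_mono
      fun x (hx : h < |N x - 1|) => by
        change h ^ 2 ≤ (N x - 1) ^ 2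
        rw [← sq_abs (N x - 1)]
        exact pow_le_pow_left₀ hh0.le hx.le 2
    have h4 : h ^ 2 * P h ≤ h ^ 2 * ((1 + ε) / 8) :=
      (mul_le_mul_of_nonneg_left h3 (sq_nonneg h)).trans (h2.trans h1)
    have := le_of_mul_le_mul_left h4 (by positivity)
    linarith
  have hstep (s : ℝ) (hs : h ≤ s) : P (s + h) ≤ P (s - h) / 4 + ε / 4 := by
    have h1 := hC n hn hL1 N hN hM hN1 (ramp s h) (lipschitzWith_ramp s h)
      {r | s - h < |r - 1|} (measurableSet_lt measurable_const (by fun_prop)) h hh0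
      fun a b hab hne => mem_or_lt_of_ramp_ne hab hne
    set m := ∫ z, ramp s h (N z) ∂(_root_.stdGaussian n)
    have hc : Continuous fun x => ramp s h (N x) :=
      (lipschitzWith_ramp s h).continuous.comp hN.continuous
    have hb (x) : ‖ramp s h (N x)‖ ≤ h := by
      rw [Real.norm_of_nonneg (show 0 ≤ ramp s h (N x) from le_max_left _ _)]
      exact max_le hh0.le (min_le_left _ _)
    have i2 : Integrable (fun x => (ramp s h (N x) - m) ^ 2) γ :=
      ((MemLp.of_bound hc.aestronglyMeasurable h (Filter.Eventually.of_forall hb)).sub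
        (memLp_const m)).integrable_sq
    have h2 := sq_mul_measure_mul_measure_le (μ := γ) (f := fun x => ramp s h (N x)) (h := h)
      (m := m) (hPm (s + h)) (hPm s).compl
      (Set.disjoint_left.2 fun x (hx : s + h < |N x - 1|) hx' =>
        hx' (show s < |N x - 1| by linarith))
      (fun x (hx : s + h < |N x - 1|) => ramp_eq hh0.le hx.le)
      (fun x hx => ramp_eq_zero (not_lt.1 hx)) i2
    rw [probReal_compl_eq_one_sub (hPm s)] at h2
    have h3 : h ^ 2 * (P (s + h) * (1 - P s)) ≤ C * (P (s - h) / L ^ 2 + ν) := h2.trans h1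
    have e : C * (P (s - h) / L ^ 2 + ν) = h ^ 2 * ((P (s - h) + ε) / 8) := by
      rw [hhsq, hε]
      field_simp
    rw [e] at h3
    have h4 := le_of_mul_le_mul_left h3 (by positivity)
    have h5 : P s ≤ 1 / 2 := (hanti hs).trans hPh
    nlinarith [hP0 (s + h)]
  have hiter (k : ℕ) : P (2 * k * h) ≤ (1 / 4) ^ k + ε := by
    induction k with
    | zero =>
      have := hP1 (2 * ((0 : ℕ) : ℝ) * h)
      simp only [pow_zero]
      linarith
    | succ k ih =>
      have hk : 0 ≤ (k : ℝ) * h := by positivity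
      have h1 := hstep (2 * k * h + h) (by linarith)
      rw [show 2 * (k : ℝ) * h + h - h = 2 * k * h by ring] at h1
      rw [show 2 * ((k + 1 : ℕ) : ℝ) * h = 2 * k * h + h + h by push_cast; ring, pow_succ]
      linarith
  set k := ⌊t * L / (2 * A)⌋₊ with hk
  have hk1 : (k : ℝ) ≤ t * L / (2 * A) := Nat.floor_le (by positivity)
  have hk2 : t * L / (2 * A) < k + 1 := Nat.lt_floor_add_one _
  have hkt : 2 * k * h ≤ t := by
    rw [hh]
    calc 2 * (k : ℝ) * (A / L) ≤ 2 * (t * L / (2 * A)) * (A / L) := by gcongr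
      _ = t := by field_simp
  have hmin1 := min_le_left (1 / (2 * A)) (1 / 2304)
  have hmin2 := min_le_right (1 / (2 * A)) (1 / 2304)
  set c := min (1 / (2 * A)) (1 / 2304)
  have htL : 0 ≤ t * L := by positivity
  have hq : (1 / 4 : ℝ) ^ k ≤ 3 * Real.exp (-(c * t * L)) := by
    have e1 : (1 / 4 : ℝ) ≤ Real.exp (-1) := by
      rw [Real.exp_neg, one_div]
      exact inv_anti₀ (Real.exp_pos _) (Real.exp_one_lt_d9.le.trans (by norm_num))
    calc (1 / 4 : ℝ) ^ k ≤ Real.exp (-1) ^ k := pow_le_pow_left₀ (by norm_num) e1 k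
      _ = Real.exp (-(k : ℝ)) := by rw [← Real.exp_nat_mul]; congr 1; ring
      _ ≤ Real.exp (1 + -(c * t * L)) := by
        refine Real.exp_le_exp.2 ?_
        have : c * (t * L) ≤ 1 / (2 * A) * (t * L) := mul_le_mul_of_nonneg_right hmin1 htL
        rw [one_div_mul_eq_div] at this
        linarith
      _ ≤ 3 * Real.exp (-(c * t * L)) := by
        rw [Real.exp_add]
        have := Real.exp_one_lt_d9
        gcongr
        linarith
  have hq2 : ε ≤ 8192 * Real.exp (-(c * t * L)) := by
    refine hεle.trans ?_
    gcongr
    have h1 : c * (t * L) ≤ 1 / 2304 * (t * L) := mul_le_mul_of_nonneg_right hmin2 htL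
    have h2 : t * L ≤ 36 * L := mul_le_mul_of_nonneg_right ht36 hL0.le
    linarith
  calc P t ≤ P (2 * k * h) := hanti hkt
    _ ≤ (1 / 4) ^ k + ε := hiter k
    _ ≤ _ := by linarith

end Deviation

section Main

lemma exists_measure_lt_abs_sub_one_le_max : ∃ C > (0 : ℝ), ∃ c > (0 : ℝ), ∀ n : ℕ, 1 ≤ n →
    ∀ N : (Fin n → ℝ) → ℝ,
    IsUncondSeminorm N → MinimalMPosition n N → ∫ x, N x ∂(_root_.stdGaussian n) = 1 →
    ∀ t > (0 : ℝ), (_root_.stdGaussian n).real {x | t < |N x - 1|}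
      ≤ C * Real.exp (-c * max (t ^ 2) t * Real.log n) := by
  obtain ⟨C₁, hC₁, c₁, hc₁, L₀, hL₀, h⟩ := exists_measure_lt_abs_sub_one_le
  set L₂ := max L₀ (C₁ / c₁) with hL₂
  have hL₂0 : 0 < L₂ := lt_of_lt_of_le (by linarith) (le_max_left _ _)
  set c₂ := min c₁ (2 / L₂) with hc₂
  have hc₂0 : 0 < c₂ := by positivity
  set c := min (c₁ / 36) (c₂ / 2592) with hc
  have hc0 : 0 < c := by positivity
  refine ⟨C₁ + Real.exp (c * 1296 * L₀) + 1, by positivity, c, hc0,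
    fun n hn N hN hM hN1 t ht => ?_⟩
  set γ := _root_.stdGaussian n with hγ
  set L := Real.log n with hL
  have hLn : 0 ≤ L := Real.log_nonneg (by exact_mod_cast hn)
  have hexp : 0 < Real.exp (-c * max (t ^ 2) t * L) := Real.exp_pos _
  have hexp0 : 0 < Real.exp (c * 1296 * L₀) := Real.exp_pos _
  rcases le_or_gt t 36 with ht36 | ht36
  · have hmax : max (t ^ 2) t ≤ 36 * t := max_le (by nlinarith) (by linarith)
    have hmax0 : 0 ≤ max (t ^ 2) t := le_max_of_le_right ht.le
    rcases le_or_gt L₀ L with hLL | hLL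
    · calc γ.real {x | t < |N x - 1|} ≤ C₁ * Real.exp (-(c₁ * t * L)) :=
            h n hn hLL N hN hM hN1 t ht.le ht36
        _ ≤ C₁ * Real.exp (-c * max (t ^ 2) t * L) := by
            gcongr
            have h1 : c * max (t ^ 2) t ≤ c₁ / 36 * (36 * t) :=
              mul_le_mul (min_le_left _ _) hmax hmax0 (by positivity)
            have h2 := mul_le_mul_of_nonneg_right h1 hLn
            linarith
        _ ≤ _ := by
            gcongr
            linarith
    · have h1 : max (t ^ 2) t * L ≤ 1296 * L₀ :=
        mul_le_mul (by linarith) hLL.le hLn (by norm_num)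
      have h2 := mul_le_mul_of_nonneg_left h1 hc0.le
      calc γ.real {x | t < |N x - 1|} ≤ 1 := measureReal_le_one
        _ ≤ Real.exp (c * 1296 * L₀ + -c * max (t ^ 2) t * L) := Real.one_le_exp (by linarith)
        _ = Real.exp (c * 1296 * L₀) * Real.exp (-c * max (t ^ 2) t * L) := Real.exp_add _ _
        _ ≤ _ := by
            gcongr
            linarith
  · have hmax : max (t ^ 2) t = t ^ 2 := max_eq_left (by nlinarith)
    have h11 : (10 / 9) * γ.real {x | 11 < N x} ≤ Real.exp (-(c₂ * L)) := by
      rcases le_or_gt L L₂ with hLL | hLL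
      · have h1 := mul_meas_ge_le_integral_of_nonneg (μ := γ)
          (Filter.Eventually.of_forall hN.nonneg) hN.integrable 11
        rw [hN1] at h1
        have h2 : γ.real {x | 11 < N x} ≤ γ.real {x | 11 ≤ N x} :=
          measureReal_mono fun x (hx : 11 < N x) => hx.le
        have h3 : c₂ * L ≤ 2 := by
          calc c₂ * L ≤ 2 / L₂ * L₂ := mul_le_mul (min_le_right _ _) hLL hLn (by positivity)
            _ = 2 := by field_simp
        have h4 : Real.exp (-2) ≤ Real.exp (-(c₂ * L)) := Real.exp_le_exp.2 (by linarith)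
        have h5 : (1 / 9 : ℝ) ≤ Real.exp (-2) := by
          rw [Real.exp_neg, ← one_div]
          refine one_div_le_one_div_of_le (Real.exp_pos _) ?_
          have : Real.exp 2 = Real.exp 1 ^ 2 := by rw [← Real.exp_nat_mul]; norm_num
          rw [this]
          have h6 := Real.exp_one_lt_d9
          have h7 := Real.exp_pos 1
          nlinarith
        linarith
      · have h1 := h n hn ((le_max_left _ _).trans hLL.le) N hN hM hN1 10 (by norm_num)
          (by norm_num)
        have h2 : γ.real {x | 11 < N x} ≤ γ.real {x | 10 < |N x - 1|} :=
          measureReal_mono fun x (hx : 11 < N x) => by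
            change 10 < |N x - 1|
            exact lt_of_lt_of_le (by linarith) (le_abs_self _)
        have h3 : C₁ ≤ c₁ * L := by
          have := (le_max_right L₀ (C₁ / c₁)).trans hLL.le
          rw [div_le_iff₀ hc₁] at this
          linarith
        have h4 : (10 / 9) * C₁ ≤ Real.exp (9 * (c₁ * L)) := by
          have := Real.add_one_le_exp (9 * (c₁ * L))
          linarith
        have h5 : Real.exp (-(c₁ * L)) ≤ Real.exp (-(c₂ * L)) := by
          gcongr
          exact min_le_left _ _
        calc (10 / 9) * γ.real {x | 11 < N x}
            ≤ (10 / 9) * C₁ * Real.exp (-(c₁ * 10 * L)) := by linarith [h2.trans h1]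
          _ ≤ Real.exp (9 * (c₁ * L)) * Real.exp (-(c₁ * 10 * L)) := by gcongr
          _ = Real.exp (-(c₁ * L)) := by
            rw [← Real.exp_add]
            congr 1
            ring
          _ ≤ _ := h5
    have h12 := seminorm_tail_le (μ := γ) integral_id_stdGaussian hN.add_le hN.smul hN.continuous
      hN.integrable hN1 (by positivity : 0 ≤ c₂ * L) h11 ht36.le
    calc γ.real {x | t < |N x - 1|} ≤ γ.real {x | t < N x} :=
          measureReal_mono fun x (hx : t < |N x - 1|) => by
            change t < N x
            have := hN.nonneg x
            rcases lt_abs.1 hx with h1 | h1 <;> linarith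
      _ ≤ Real.exp (-(c₂ * L * t ^ 2 / 2592)) := h12
      _ ≤ Real.exp (-c * max (t ^ 2) t * L) := by
          rw [hmax]
          refine Real.exp_le_exp.2 ?_
          have h1 : c * (t ^ 2 * L) ≤ c₂ / 2592 * (t ^ 2 * L) := by
            gcongr
            exact min_le_right _ _
          linarith
      _ ≤ _ := le_mul_of_one_le_left hexp.le (by linarith)

namespace IsUncondSeminorm

variable {n : ℕ} {N : (Fin n → ℝ) → ℝ}

lemma const_mul (hN : IsUncondSeminorm N) {c : ℝ} (hc : 0 ≤ c) :
    IsUncondSeminorm fun x => c * N x where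
  add_le x y := by
    rw [← mul_add]
    exact mul_le_mul_of_nonneg_left (hN.add_le x y) hc
  smul r x := by
    rw [hN.smul]
    ring
  sign ε hε x := by rw [hN.sign ε hε]

lemma integral_pos (hN : IsUncondSeminorm N) (h0 : ∀ x, N x = 0 → x = 0) (hn : 1 ≤ n) :
    0 < ∫ x, N x ∂(_root_.stdGaussian n) := by
  refine (integral_nonneg hN.nonneg).lt_of_ne' fun h => ?_
  have h1 := hN.single_le ⟨0, hn⟩
  rw [h, mul_zero] at h1
  have h2 := congrFun (h0 _ (le_antisymm h1 (hN.nonneg _))) ⟨0, hn⟩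
  simp at h2

lemma mul_log_le_critDim (hN : IsUncondSeminorm N) (h0 : ∀ x, N x = 0 → x = 0) (hn : 1 ≤ n)
    {B : ℝ} (hB : 0 < B)
    (h : ∀ y : Fin n → ℝ, (∀ x, ∑ i, y i * x i ≤ (∫ x, N x ∂(_root_.stdGaussian n))⁻¹ * N x) →
      (∑ i, y i ^ 2) * Real.log n ≤ B) :
    1 / B * Real.log n ≤ critDim n N := by
  set I := ∫ x, N x ∂(_root_.stdGaussian n) with hI
  have hI0 : 0 < I := hN.integral_pos h0 hn
  rcases (Real.log_nonneg (by exact_mod_cast hn : (1 : ℝ) ≤ n)).eq_or_lt with hL | hL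
  · rw [← hL, mul_zero]
    exact sq_nonneg _
  have hle : ∀ θ : Fin n → ℝ, euclNorm θ = 1 → N θ ≤ I * √(B / Real.log n) := fun θ hθ => by
    obtain ⟨y, hy, hyθ⟩ := (hN.const_mul (inv_nonneg.2 hI0.le)).exists_supporting θ
    have h1 := Finset.sum_mul_sq_le_sq_mul_sq Finset.univ y θ
    have h2 : ∑ i, θ i ^ 2 = 1 := by
      rw [euclNorm, Real.sqrt_eq_one] at hθ
      exact hθ
    have h3 : ∑ i, y i ^ 2 ≤ B / Real.log n := (le_div_iff₀ hL).2 (h y hy)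
    have h4 : I⁻¹ * N θ ≤ √(B / Real.log n) := by
      rw [← hyθ]
      refine Real.le_sqrt_of_sq_le (h1.trans ?_)
      rwa [h2, mul_one]
    rwa [inv_mul_le_iff₀ hI0] at h4
  have hθ₀ : euclNorm (Pi.single (⟨0, hn⟩ : Fin n) (1 : ℝ)) = 1 := by
    rw [euclNorm, Real.sqrt_eq_one, Finset.sum_eq_single ⟨0, hn⟩] <;> simp +contextual
  have hb0 : 0 < bConst N := by
    have hpos : 0 < N (Pi.single (⟨0, hn⟩ : Fin n) (1 : ℝ)) :=
      (hN.nonneg _).lt_of_ne' fun h1 => by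
        have h2 := congrFun (h0 _ h1) ⟨0, hn⟩
        simp at h2
    refine hpos.trans_le (le_csSup ⟨I * √(B / Real.log n), ?_⟩ ⟨_, hθ₀, rfl⟩)
    rintro _ ⟨θ, hθ, rfl⟩
    exact hle θ hθ
  have hb : bConst N ≤ I * √(B / Real.log n) := by
    refine csSup_le ⟨_, _, hθ₀, rfl⟩ ?_
    rintro _ ⟨θ, hθ, rfl⟩
    exact hle θ hθ
  have hb2 : bConst N ^ 2 ≤ I ^ 2 * (B / Real.log n) := by
    have := pow_le_pow_left₀ hb0.le hb 2
    rwa [mul_pow, Real.sq_sqrt (by positivity)] at this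
  rw [critDim, ← hI, div_pow, le_div_iff₀ (by positivity)]
  calc 1 / B * Real.log n * bConst N ^ 2
      ≤ 1 / B * Real.log n * (I ^ 2 * (B / Real.log n)) := by gcongr
    _ = I ^ 2 := by field_simp

end IsUncondSeminorm

end Main

/-- For a 1-unconditional norm in position of minimal `M`: `k(X) ≥ c log n` and
`P(|N(G) − E N(G)| > t E N(G)) ≤ C exp(−c max{t², t} log n)`. -/
theorem statement6 :
    ∃ C > (0 : ℝ), ∃ c > (0 : ℝ), ∀ n : ℕ, 1 ≤ n →
      ∀ N : (Fin n → ℝ) → ℝ,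
        (∀ x y, N (x + y) ≤ N x + N y) →
        (∀ (r : ℝ) (x), N (r • x) = |r| * N x) →
        (∀ x, N x = 0 → x = 0) →
        (∀ ε : Fin n → ℝ, (∀ i, ε i = 1 ∨ ε i = -1) →
          ∀ x : Fin n → ℝ, N (fun i => ε i * x i) = N x) →
        MinimalMPosition n N →
        c * Real.log n ≤ critDim n N ∧
          ∀ t > (0 : ℝ),
            stdGaussian n
                {x | t * (∫ y, N y ∂stdGaussian n) < |N x - ∫ y, N y ∂stdGaussian n|}
              ≤ ENNReal.ofReal
                  (C * Real.exp (-c * max (t ^ 2) t * Real.log n)) := by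
  obtain ⟨C, hC, c, hc, hdev⟩ := exists_measure_lt_abs_sub_one_le_max
  obtain ⟨B, hB, hdual⟩ := exists_sum_sq_mul_log_le
  refine ⟨C, hC, min c (1 / B), by positivity, fun n hn N hadd hsmul h0 hsign hM => ?_⟩
  have hN : IsUncondSeminorm N := ⟨hadd, hsmul, hsign⟩
  have hI0 := hN.integral_pos h0 hn
  set I := ∫ x, N x ∂(_root_.stdGaussian n) with hI
  have hL : 0 ≤ Real.log n := Real.log_nonneg (by exact_mod_cast hn)
  have hN' : IsUncondSeminorm fun x => I⁻¹ * N x := hN.const_mul (inv_nonneg.2 hI0.le)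
  have hN'1 : ∫ x, I⁻¹ * N x ∂(_root_.stdGaussian n) = 1 := by
    rw [integral_const_mul, ← hI, inv_mul_cancel₀ hI0.ne']
  have hM' : MinimalMPosition n fun x => I⁻¹ * N x := fun T hT => by
    rw [integral_const_mul, integral_const_mul]
    exact mul_le_mul_of_nonneg_left (hM T hT) (inv_nonneg.2 hI0.le)
  constructor
  · refine le_trans ?_ (hN.mul_log_le_critDim h0 hn hB (hdual n hn _ hN' hM' hN'1))
    gcongr
    exact min_le_right _ _
  · intro t ht
    have e : {x | t * I < |N x - I|} = {x | t < |I⁻¹ * N x - 1|} := by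
      ext x
      have e1 : I⁻¹ * N x - 1 = (N x - I) / I := by field_simp
      rw [Set.mem_ofPred_eq, Set.mem_ofPred_eq, e1, abs_div, abs_of_pos hI0, lt_div_iff₀ hI0]
    rw [e, ← ofReal_measureReal]
    refine ENNReal.ofReal_le_ofReal ((hdev n hn _ hN' hM' hN'1 t ht).trans ?_)
    have hm : 0 ≤ max (t ^ 2) t := le_max_of_le_right ht.le
    have h1 : min c (1 / B) * (max (t ^ 2) t * Real.log n) ≤ c * (max (t ^ 2) t * Real.log n) := by
      gcongr
      exact min_le_left _ _
    gcongr C * Real.exp ?_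
    linarith
end

section
/- Let ‖·‖ be a norm on ℝ^{2s} and suppose u₁, …, u_{2s} is an orthonormal basis of ℝ^{2s} (with respect to the standard inner product) such that ‖uᵢ‖ ≤ 1 for all i and ‖uᵢ‖ ≥ 1/√2 for all i ≤ s. Then there exists an orthonormal basis w₁, …, w_{2s} of ℝ^{2s} such that ‖wᵢ‖ ≥ 1/4 for every i = 1, …, 2s. Explicitly, for each i = 1, …, s one may take w_{s−i+1} = u_{s−i+1} and w_{s+i} = u_{s+i} if ‖u_{s+i}‖ ≥ 1/4, and w_{s−i+1} = (u_{s−i+1} + u_{s+i})/√2, w_{s+i} = (u_{s−i+1} − u_{s+i})/√2 otherwise. -/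
open Real

/-- The standard inner product on `ℝᵈ`. -/
def dotProd {d : ℕ} (x y : Fin d → ℝ) : ℝ := ∑ i, x i * y i

/-- If `σ` is a fixed-point-free involution of the index set, rotating or reflecting an orthonormal
family inside the planes spanned by `u i` and `u (σ i)` gives an orthonormal family. -/
theorem dotProd_pairwise_combination {d : ℕ} {u : Fin d → Fin d → ℝ}
    (hu : ∀ i j, dotProd (u i) (u j) = if i = j then 1 else 0)
    {σ : Fin d → Fin d} (hσ : Function.Involutive σ) (hfix : ∀ i, σ i ≠ i) {a b : Fin d → ℝ}
    (hnorm : ∀ i, a i ^ 2 + b i ^ 2 = 1) (hcross : ∀ i, a i * b (σ i) + b i * a (σ i) = 0)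
    (i j : Fin d) :
    dotProd (a i • u i + b i • u (σ i)) (a j • u j + b j • u (σ j)) = if i = j then 1 else 0 := by
  have expand : dotProd (a i • u i + b i • u (σ i)) (a j • u j + b j • u (σ j)) =
      a i * a j * dotProd (u i) (u j) + a i * b j * dotProd (u i) (u (σ j)) +
        b i * a j * dotProd (u (σ i)) (u j) + b i * b j * dotProd (u (σ i)) (u (σ j)) := by
    simp only [dotProd, Finset.mul_sum, ← Finset.sum_add_distrib]
    refine Finset.sum_congr rfl fun k _ => ?_
    simp only [Pi.add_apply, Pi.smul_apply, smul_eq_mul]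
    ring
  rw [expand, hu, hu, hu, hu]
  by_cases hij : i = j
  · subst hij
    simp only [hfix, (hfix i).symm, if_true, if_false]
    linarith [hnorm i]
  · by_cases hj : j = σ i
    · subst hj
      simp only [hσ i, hij, hfix, if_true, if_false]
      linarith [hcross i]
    · have h1 : i ≠ σ j := fun h => hj (by rw [h, hσ j])
      have h2 : σ i ≠ σ j := fun h => hij (hσ.injective h)
      simp [hij, h1, h2, Ne.symm hj]

/-- A combination with coefficients `±1/√2` of a vector of norm at least `1/√2` and
one of norm at most `1/4` has norm at least `1/4`. -/
theorem quarter_le_of_abs_eq_inv_sqrt_two {E : Type*} [AddCommGroup E] [Module ℝ E] {N : E → ℝ}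
    (hadd : ∀ x y, N (x + y) ≤ N x + N y) (hsmul : ∀ (r : ℝ) (x), N (r • x) = |r| * N x)
    {x y : E} (hx : 1 / √2 ≤ N x) (hy : N y ≤ 1 / 4) {a b : ℝ}
    (ha : |a| = 1 / √2) (hb : |b| = 1 / √2) : 1 / 4 ≤ N (a • x + b • y) := by
  have h := hadd (a • x + b • y) ((-b) • y)
  rw [neg_smul, add_neg_cancel_right, ← neg_smul, hsmul a, hsmul (-b), abs_neg, ha, hb] at h
  have hc : (1 / √2) ^ 2 = 1 / 2 := by simp
  have hpos : 0 < 1 / √2 := by positivity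
  nlinarith [mul_le_mul_of_nonneg_left hx hpos.le, mul_le_mul_of_nonneg_left hy hpos.le]

/-- (Johnson's remark on the Dvoretzky–Rogers lemma.) Let `N` be a norm on `ℝ^{2s}`
and `u₁,…,u_{2s}` an orthonormal basis with `N(uᵢ) ≤ 1` for all `i` and
`N(uᵢ) ≥ 1/√2` for the first `s` indices. Then there is an orthonormal basis
`w₁,…,w_{2s}` with `N(wᵢ) ≥ 1/4` for all `i`. -/
theorem statement11 (s : ℕ) (N : (Fin (2 * s) → ℝ) → ℝ)
    (hadd : ∀ x y, N (x + y) ≤ N x + N y)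
    (hsmul : ∀ (r : ℝ) (x), N (r • x) = |r| * N x)
    (hdef : ∀ x, N x = 0 → x = 0)
    (u : Fin (2 * s) → Fin (2 * s) → ℝ)
    (hortho : ∀ i j, dotProd (u i) (u j) = if i = j then 1 else 0)
    (hub : ∀ i, N (u i) ≤ 1)
    (hlb : ∀ i : Fin (2 * s), (i : ℕ) < s → 1 / Real.sqrt 2 ≤ N (u i)) :
    ∃ w : Fin (2 * s) → Fin (2 * s) → ℝ,
      (∀ i j, dotProd (w i) (w j) = if i = j then 1 else 0) ∧
      ∀ i, 1 / 4 ≤ N (w i) := by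
  classical
  have hc : (1 / √2) ^ 2 = 1 / 2 := by simp
  have hpos : 0 < 1 / √2 := by positivity
  have hquarter : 1 / 4 < 1 / √2 := by nlinarith
  let small : Fin (2 * s) → Prop := fun i => N (u i) < 1 / 4 ∨ N (u i.rev) < 1 / 4
  have small_rev (i) : small i.rev ↔ small i := by simp only [small, Fin.rev_rev, or_comm]
  have rev_lt (i : Fin (2 * s)) : (i.rev : ℕ) < s ↔ ¬ (i : ℕ) < s := by
    rw [Fin.val_rev]
    omega
  let a : Fin (2 * s) → ℝ := fun i =>
    if small i then if (i : ℕ) < s then 1 / √2 else -(1 / √2) else 1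
  let b : Fin (2 * s) → ℝ := fun i => if small i then 1 / √2 else 0
  refine ⟨fun i => a i • u i + b i • u i.rev,
    dotProd_pairwise_combination hortho Fin.rev_rev ?_ ?_ ?_, fun i => ?_⟩
  · intro i h
    have := rev_lt i
    rw [h] at this
    tauto
  · intro i
    simp only [a, b]
    split_ifs <;> linarith
  · intro i
    by_cases hs : small i <;> by_cases hi : (i : ℕ) < s <;>
      simp only [a, b, small_rev, rev_lt, hs, hi, not_true, not_false_iff, if_true, if_false] <;> ring
  · by_cases hs : small i
    · have hb : |b i| = 1 / √2 := by simp only [b, if_pos hs, abs_of_pos hpos]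
      have ha : |a i| = 1 / √2 := by
        simp only [a, if_pos hs]
        split_ifs <;> simp only [abs_neg, abs_of_pos hpos]
      by_cases hi : (i : ℕ) < s
      · have hx := hlb i hi
        have hy : N (u i.rev) ≤ 1 / 4 := by rcases hs with h | h <;> linarith
        exact quarter_le_of_abs_eq_inv_sqrt_two hadd hsmul hx hy ha hb
      · have hx := hlb i.rev ((rev_lt i).2 hi)
        have hy : N (u i) ≤ 1 / 4 := by rcases hs with h | h <;> linarith
        dsimp only
        rw [add_comm]
        exact quarter_le_of_abs_eq_inv_sqrt_two hadd hsmul hx hy hb ha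
    · have hi : 1 / 4 ≤ N (u i) := not_lt.1 fun h => hs (Or.inl h)
      simpa [a, b, hs] using hi
end
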